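/- Let d ≥ 3 be an integer. There is a constant C = C(d) such that for every j ∈ ℕ, with Λ = 2^j and N = Λ^{1/2}, and every f ∈ l²(ℤ^d), ‖ sup_{λ ∈ ℕ ∩ [Λ, 2Λ)} |E_{m,λ} f| ‖_{l²(ℤ^d)} ≤ C · N(Λ)^{-1} · ( ∫_{m_N} sup_{ξ ∈ ℝ^d} |F_N(θ,ξ)| · |F_N(θ)| dθ ) · ‖f‖_{l²(ℤ^d)}. -/

import Mathlib

open scoped ENNReal NNReal BigOperators Real
open MeasureTheory

noncomputable section

/-- `ℤ^d` -/
abbrev V (d : ℕ) := Fin d → ℤ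

/-- The sphere `{(u,v) ∈ ℤ^d × ℤ^d : |u|² + |v|² = λ}`. -/
def sph (d lam : ℕ) : Set (V d × V d) :=
  {uv | (∑ i, uv.1 i ^ 2) + (∑ i, uv.2 i ^ 2) = (lam : ℤ)}

/-- `N(λ)`, the number of lattice points on the sphere of radius `λ^{1/2}` in `ℝ^{2d}`. -/
def Ncount (d lam : ℕ) : ℕ := Nat.card (sph d lam)

/-- `e(t) = e^{2πit}`. -/
def eC (t : ℝ) : ℂ := Complex.exp (2 * Real.pi * Complex.I * t)

/-- The quadratic Weyl sum `S_N(θ,ξ) = Σ_{u ∈ ℤ, 0 ≤ u ≤ N} e(θu² + ξu)`. -/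
def SN (N θ ξ : ℝ) : ℂ :=
  ∑ u ∈ Finset.range (⌊N⌋₊ + 1), eC (θ * (u : ℝ) ^ 2 + ξ * (u : ℝ))

/-- `F_N(θ,ξ) = Π_{i=1}^d S_N(θ,ξ_i)` for `ξ ∈ ℝ^d`. -/
def FN (d : ℕ) (N θ : ℝ) (ξ : Fin d → ℝ) : ℂ := ∏ i, SN N θ (ξ i)

/-- `F_N(θ) = S_N(θ,0)^d`. -/
def FN0 (d : ℕ) (N θ : ℝ) : ℂ := SN N θ 0 ^ d

/-- The major arcs at scale `N`:
`M_N = ∪_{1 ≤ q ≤ N} ∪_{1 ≤ a ≤ q, (a,q)=1} {θ ∈ [0,1] : |θ - a/q| ≤ 1/(8qN)}`. -/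
def majorArcs (N : ℝ) : Set ℝ :=
  ⋃ (q : ℕ) (_ : 1 ≤ q ∧ (q : ℝ) ≤ N) (a : ℕ) (_ : 1 ≤ a ∧ a ≤ q ∧ Nat.gcd a q = 1),
    {θ : ℝ | θ ∈ Set.Icc (0 : ℝ) 1 ∧ |θ - (a : ℝ) / q| ≤ 1 / (8 * q * N)}

/-- The minor arcs `m_N = [0,1] \ M_N`. -/
def minorArcs (N : ℝ) : Set ℝ := Set.Icc (0 : ℝ) 1 \ majorArcs N

/-- The lattice box `ℤ^d ∩ [0,N]^d`. -/
def box (d : ℕ) (N : ℝ) : Finset (V d) :=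
  Fintype.piFinset fun _ => Finset.Icc (0 : ℤ) ⌊N⌋

/-- The minor-arc error operator
`E_{m,λ} f(x) = N(λ)⁻¹ ∫_{m_N} Σ_{u,v ∈ ℤ^d ∩ [0,N]^d} e(θ(|u|² + |v|² - λ)) f(x-u) dθ`. -/
def Eminor (d lam : ℕ) (N : ℝ) (f : V d → ℂ) (x : V d) : ℂ :=
  (Ncount d lam : ℂ)⁻¹ *
    ∫ θ in minorArcs N,
      ∑ u ∈ box d N, ∑ v ∈ box d N,
        eC (θ * (((∑ i, u i ^ 2) + (∑ i, v i ^ 2) - (lam : ℤ) : ℤ) : ℝ)) * f (x - u)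

/-- The `l^p(ℤ^d)` norm of a complex-valued function. -/
def lpNorm (d : ℕ) (p : ℝ) (f : V d → ℂ) : ℝ≥0∞ :=
  (∑' x : V d, (‖f x‖₊ : ℝ≥0∞) ^ p) ^ (1 / p)

/-- The `l^p(ℤ^d)` norm of an `ℝ≥0∞`-valued function. -/
def lpNormE (d : ℕ) (p : ℝ) (F : V d → ℝ≥0∞) : ℝ≥0∞ :=
  (∑' x : V d, F x ^ p) ^ (1 / p)

/-- Odd integers of absolute value at most `R`. -/
def oddIcc (R : ℤ) : Finset ℤ := (Finset.Icc (-R) R).filter Odd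

/-- Positive integers `(d, s)`, together with an odd `x`, all at most `R` in absolute value, with
`x² + 4ds = M`. -/
def oddForms (R M : ℤ) : Finset (ℤ × ℤ × ℤ) :=
  (oddIcc R ×ˢ Finset.Icc 1 R ×ˢ Finset.Icc 1 R).filter fun p =>
    p.1 ^ 2 + 4 * (p.2.1 * p.2.2) = M

lemma mem_oddForms {R M : ℤ} (hR : M ≤ R) {x d s : ℤ} :
    (x, d, s) ∈ oddForms R M ↔ Odd x ∧ 0 < d ∧ 0 < s ∧ x ^ 2 + 4 * (d * s) = M := by
  simp only [oddForms, oddIcc, Finset.mem_filter, Finset.mem_product, Finset.mem_Icc]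
  constructor
  · rintro ⟨⟨⟨⟨h1, h2⟩, h3⟩, ⟨h4, h5⟩, h6, h7⟩, h8⟩
    exact ⟨h3, by omega, by omega, h8⟩
  · rintro ⟨h1, h2, h3, h4⟩
    have h0 := mul_pos h2 h3
    have h5 : x ≤ R := by linarith [Int.le_self_sq x]
    have h6 : -R ≤ x := by linarith [Int.le_self_sq (-x), neg_sq x]
    have h7 : d ≤ R := by nlinarith
    have h8 : s ≤ R := by nlinarith
    exact ⟨⟨⟨⟨h6, h5⟩, h1⟩, ⟨by omega, h7⟩, by omega, h8⟩, h4⟩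

lemma odd_of_mem_oddForms {x d s k : ℤ} (hx : Odd x) (h : x ^ 2 + 4 * (d * s) = 8 * k + 5) :
    Odd d ∧ Odd s := by
  obtain ⟨y, rfl⟩ := hx
  obtain ⟨z, hz⟩ := Int.even_mul_succ_self y
  have : d * s = 2 * (k - z) + 1 := by nlinarith
  exact Int.odd_mul.mp ⟨_, this⟩

/-- An involution on indefinite binary quadratic forms of discriminant `8k + 5`. -/
lemma sum_oddForms (R k : ℤ) (hR : 8 * k + 5 ≤ R) :
    ∑ p ∈ oddForms R (8 * k + 5), (p.2.1 * p.2.2 - p.1 ^ 2) * p.2.1 = 0 := by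
  set T := oddForms R (8 * k + 5) with hT
  have hodd : ∑ p ∈ T, p.1 * p.2.1 ^ 2 = 0 := by
    have h : ∑ p ∈ T, p.1 * p.2.1 ^ 2 = ∑ p ∈ T, -(p.1 * p.2.1 ^ 2) := by
      refine Finset.sum_nbij' (fun p => (-p.1, p.2.1, p.2.2)) (fun p => (-p.1, p.2.1, p.2.2))
        ?_ ?_ ?_ ?_ ?_
      · rintro ⟨x, d, s⟩ h
        rw [hT, mem_oddForms hR] at h ⊢
        exact ⟨h.1.neg, h.2.1, h.2.2.1, by linarith [h.2.2.2, neg_sq x]⟩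
      · rintro ⟨x, d, s⟩ h
        rw [hT, mem_oddForms hR] at h ⊢
        exact ⟨h.1.neg, h.2.1, h.2.2.1, by linarith [h.2.2.2, neg_sq x]⟩
      · simp
      · simp
      · simp
    rw [Finset.sum_neg_distrib] at h
    linarith
  set F : ℤ × ℤ × ℤ → ℤ :=
    fun p => (p.2.1 * p.2.2 - p.1 ^ 2) * p.2.1 + p.1 * p.2.1 ^ 2 with hF
  set A := T.filter fun p => p.1 + p.2.2 < p.2.1 with hA
  have hK : ∑ p ∈ T, F p = ∑ p ∈ A, (p.2.1 + p.2.2) * (p.2.1 - p.1) * (p.2.2 + p.1) := by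
    rw [← Finset.sum_filter_add_sum_filter_not T (fun p => p.1 + p.2.2 < p.2.1) F]
    have : ∑ p ∈ T with ¬ (p.1 + p.2.2 < p.2.1), F p =
        ∑ p ∈ A, ((p.2.1 * p.2.2 - p.1 ^ 2) * p.2.2 - p.1 * p.2.2 ^ 2) := by
      refine Finset.sum_nbij' (fun p => (-p.1, p.2.2, p.2.1)) (fun p => (-p.1, p.2.2, p.2.1))
        ?_ ?_ ?_ ?_ ?_
      · rintro ⟨x, d, s⟩ h
        rw [Finset.mem_filter, hT, mem_oddForms hR] at h
        rw [hA, Finset.mem_filter, hT, mem_oddForms hR]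
        obtain ⟨⟨h1, h2, h3, h4⟩, h5⟩ := h
        obtain ⟨h6, h7⟩ := odd_of_mem_oddForms h1 h4
        refine ⟨⟨h1.neg, h3, h2, by linarith [neg_sq x, mul_comm d s]⟩, ?_⟩
        obtain ⟨x', rfl⟩ := h1
        obtain ⟨d', rfl⟩ := h6
        obtain ⟨s', rfl⟩ := h7
        simp only at h5 ⊢
        omega
      · rintro ⟨x, d, s⟩ h
        rw [hA, Finset.mem_filter, hT, mem_oddForms hR] at h
        rw [Finset.mem_filter, hT, mem_oddForms hR]
        obtain ⟨⟨h1, h2, h3, h4⟩, h5⟩ := h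
        refine ⟨⟨h1.neg, h3, h2, by linarith [neg_sq x, mul_comm d s]⟩, ?_⟩
        simp only at h5 ⊢
        omega
      · simp
      · simp
      · rintro ⟨x, d, s⟩ _
        simp only [hF]
        ring
    rw [this, ← hA, ← Finset.sum_add_distrib]
    refine Finset.sum_congr rfl fun p _ => ?_
    simp only [hF]
    ring
  have hanti : ∑ p ∈ A, (p.2.1 + p.2.2) * (p.2.1 - p.1) * (p.2.2 + p.1) =
      ∑ p ∈ A, -((p.2.1 + p.2.2) * (p.2.1 - p.1) * (p.2.2 + p.1)) := by
    have hmem : ∀ p ∈ A, (-p.1 - 2 * p.2.2, p.2.1 - p.1 - p.2.2, p.2.2) ∈ A := by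
      rintro ⟨x, d, s⟩ h
      rw [hA, Finset.mem_filter, hT, mem_oddForms hR] at h ⊢
      obtain ⟨⟨h1, h2, h3, h4⟩, h5⟩ := h
      simp only at h5 ⊢
      refine ⟨⟨?_, by omega, h3, by linarith⟩, by omega⟩
      obtain ⟨y, rfl⟩ := h1
      exact ⟨-y - 1 - s, by ring⟩
    refine Finset.sum_nbij' (fun p => (-p.1 - 2 * p.2.2, p.2.1 - p.1 - p.2.2, p.2.2))
      (fun p => (-p.1 - 2 * p.2.2, p.2.1 - p.1 - p.2.2, p.2.2)) hmem hmem ?_ ?_ ?_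
    · rintro ⟨x, d, s⟩ _
      simp only [Prod.mk.injEq, and_true]
      constructor <;> ring
    · rintro ⟨x, d, s⟩ _
      simp only [Prod.mk.injEq, and_true]
      constructor <;> ring
    · rintro ⟨x, d, s⟩ _
      ring
  rw [Finset.sum_neg_distrib] at hanti
  have h0 : ∑ p ∈ T, F p = 0 := by linarith
  simp only [hF, Finset.sum_add_distrib, hodd, add_zero] at h0
  exact h0

/-- The number of representations of `n` as a sum of four odd squares (of integers at most `R`). -/
def oddRep (R n : ℤ) : Finset (ℤ × ℤ × ℤ × ℤ) :=
  (oddIcc R ×ˢ oddIcc R ×ˢ oddIcc R ×ˢ oddIcc R).filter fun p =>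
    p.1 ^ 2 + p.2.1 ^ 2 + p.2.2.1 ^ 2 + p.2.2.2 ^ 2 = n

/-- The sum of the divisors of `n / 4` (in `[1, R]`, with cofactor in `[1, R]`). -/
def divSum (R n : ℤ) : ℤ :=
  ∑ p ∈ (Finset.Icc 1 R ×ˢ Finset.Icc 1 R).filter (fun p : ℤ × ℤ => 4 * (p.1 * p.2) = n), p.1

lemma sum_divSum (R k : ℤ) (hR : 8 * k + 5 ≤ R) :
    ∑ x ∈ oddIcc R, (8 * k + 5 - 5 * x ^ 2) * divSum R (8 * k + 5 - x ^ 2) = 0 := by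
  have h := sum_oddForms R k hR
  rw [oddForms, Finset.sum_filter, Finset.sum_product] at h
  have h4 : 4 * (0 : ℤ) = 0 := by norm_num
  rw [← h4, ← h, Finset.mul_sum]
  refine Finset.sum_congr rfl fun x _ => ?_
  rw [divSum, Finset.sum_filter, Finset.mul_sum, Finset.mul_sum]
  refine Finset.sum_congr rfl fun p _ => ?_
  by_cases hp : 4 * (p.1 * p.2) = 8 * k + 5 - x ^ 2
  · rw [if_pos hp, if_pos (by linarith)]
    have : 8 * k + 5 = 4 * (p.1 * p.2) + x ^ 2 := by linarith
    rw [this]; ring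
  · rw [if_neg hp, if_neg (fun h' => hp (by linarith))]
    ring

lemma sum_oddRep (R M : ℤ) :
    ∑ x ∈ oddIcc R, (M - 5 * x ^ 2) * ((oddRep R (M - x ^ 2)).card : ℤ) = 0 := by
  set O := oddIcc R
  set P := (O ×ˢ O ×ˢ O ×ˢ O ×ˢ O).filter fun p =>
    p.1 ^ 2 + p.2.1 ^ 2 + p.2.2.1 ^ 2 + p.2.2.2.1 ^ 2 + p.2.2.2.2 ^ 2 = M with hP
  have h1 : ∑ x ∈ O, (M - 5 * x ^ 2) * ((oddRep R (M - x ^ 2)).card : ℤ) =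
      ∑ p ∈ P, (M - 5 * p.1 ^ 2) := by
    rw [hP, Finset.sum_filter, Finset.sum_product]
    refine Finset.sum_congr rfl fun x _ => ?_
    rw [oddRep, Finset.card_filter, Nat.cast_sum, Finset.mul_sum]
    refine Finset.sum_congr rfl fun p _ => ?_
    by_cases hp : p.1 ^ 2 + p.2.1 ^ 2 + p.2.2.1 ^ 2 + p.2.2.2 ^ 2 = M - x ^ 2
    · rw [if_pos hp, if_pos (by linarith)]; simp
    · rw [if_neg hp, if_neg (fun h' => hp (by linarith))]; simp
  have e2 : ∑ p ∈ P, p.1 ^ 2 = ∑ p ∈ P, p.2.1 ^ 2 := by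
    refine Finset.sum_nbij' (fun p => (p.2.1, p.1, p.2.2)) (fun p => (p.2.1, p.1, p.2.2))
      ?_ ?_ ?_ ?_ ?_ <;> rintro ⟨a, b, c, d, e⟩ <;>
      simp only [hP, Finset.mem_filter, Finset.mem_product, implies_true] <;>
      rintro ⟨⟨h1, h2, h3, h4, h5⟩, h6⟩ <;>
      exact ⟨⟨by assumption, by assumption, by assumption, by assumption, by assumption⟩,
        by linarith⟩
  have e3 : ∑ p ∈ P, p.1 ^ 2 = ∑ p ∈ P, p.2.2.1 ^ 2 := by
    refine Finset.sum_nbij' (fun p => (p.2.2.1, p.2.1, p.1, p.2.2.2))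
      (fun p => (p.2.2.1, p.2.1, p.1, p.2.2.2))
      ?_ ?_ ?_ ?_ ?_ <;> rintro ⟨a, b, c, d, e⟩ <;>
      simp only [hP, Finset.mem_filter, Finset.mem_product, implies_true] <;>
      rintro ⟨⟨h1, h2, h3, h4, h5⟩, h6⟩ <;>
      exact ⟨⟨by assumption, by assumption, by assumption, by assumption, by assumption⟩,
        by linarith⟩
  have e4 : ∑ p ∈ P, p.1 ^ 2 = ∑ p ∈ P, p.2.2.2.1 ^ 2 := by
    refine Finset.sum_nbij' (fun p => (p.2.2.2.1, p.2.1, p.2.2.1, p.1, p.2.2.2.2))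
      (fun p => (p.2.2.2.1, p.2.1, p.2.2.1, p.1, p.2.2.2.2))
      ?_ ?_ ?_ ?_ ?_ <;> rintro ⟨a, b, c, d, e⟩ <;>
      simp only [hP, Finset.mem_filter, Finset.mem_product, implies_true] <;>
      rintro ⟨⟨h1, h2, h3, h4, h5⟩, h6⟩ <;>
      exact ⟨⟨by assumption, by assumption, by assumption, by assumption, by assumption⟩,
        by linarith⟩
  have e5 : ∑ p ∈ P, p.1 ^ 2 = ∑ p ∈ P, p.2.2.2.2 ^ 2 := by
    refine Finset.sum_nbij' (fun p => (p.2.2.2.2, p.2.1, p.2.2.1, p.2.2.2.1, p.1))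
      (fun p => (p.2.2.2.2, p.2.1, p.2.2.1, p.2.2.2.1, p.1))
      ?_ ?_ ?_ ?_ ?_ <;> rintro ⟨a, b, c, d, e⟩ <;>
      simp only [hP, Finset.mem_filter, Finset.mem_product, implies_true] <;>
      rintro ⟨⟨h1, h2, h3, h4, h5⟩, h6⟩ <;>
      exact ⟨⟨by assumption, by assumption, by assumption, by assumption, by assumption⟩,
        by linarith⟩
  have e6 : ∑ p ∈ P, (p.1 ^ 2 + p.2.1 ^ 2 + p.2.2.1 ^ 2 + p.2.2.2.1 ^ 2 + p.2.2.2.2 ^ 2) =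
      ∑ p ∈ P, M := Finset.sum_congr rfl fun p hp => (Finset.mem_filter.mp hp).2
  simp only [Finset.sum_add_distrib] at e6
  rw [h1, Finset.sum_sub_distrib, ← Finset.mul_sum]
  linarith

lemma one_le_sq_of_odd {x : ℤ} (hx : Odd x) : 1 ≤ x ^ 2 := by
  have : x ≠ 0 := by rintro rfl; simp at hx
  have := Int.one_le_abs this
  nlinarith [sq_abs x]

lemma oddRep_eq_empty {R n : ℤ} (hn : n < 4) : oddRep R n = ∅ := by
  refine Finset.filter_eq_empty_iff.mpr ?_
  rintro ⟨a, b, c, d⟩ h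
  simp only [oddIcc, Finset.mem_product, Finset.mem_filter] at h ⊢
  have h1 := one_le_sq_of_odd h.1.2
  have h2 := one_le_sq_of_odd h.2.1.2
  have h3 := one_le_sq_of_odd h.2.2.1.2
  have h4 := one_le_sq_of_odd h.2.2.2.2
  omega

lemma divSum_eq_zero {R n : ℤ} (hn : n < 4) : divSum R n = 0 := by
  refine Finset.sum_eq_zero ?_
  rintro ⟨a, b⟩ h
  simp only [Finset.mem_product, Finset.mem_filter, Finset.mem_Icc] at h
  nlinarith

lemma card_oddRep_four {R : ℤ} (hR : 4 ≤ R) : (oddRep R 4).card = 16 := by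
  have : oddRep R 4 = ({-1, 1} ×ˢ {-1, 1} ×ˢ {-1, 1} ×ˢ {-1, 1} : Finset (ℤ × ℤ × ℤ × ℤ)) := by
    have key : ∀ x : ℤ, x ^ 2 = 1 ↔ x = -1 ∨ x = 1 := fun x => by rw [sq_eq_one_iff]; tauto
    ext ⟨a, b, c, d⟩
    simp only [oddRep, oddIcc, Finset.mem_product, Finset.mem_filter, Finset.mem_Icc,
      Finset.mem_insert, Finset.mem_singleton, ← key]
    constructor
    · rintro ⟨⟨h1, h2, h3, h4⟩, h⟩
      have h1 := one_le_sq_of_odd h1.2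
      have h2 := one_le_sq_of_odd h2.2
      have h3 := one_le_sq_of_odd h3.2
      have h4 := one_le_sq_of_odd h4.2
      omega
    · rintro ⟨h1, h2, h3, h4⟩
      refine ⟨⟨?_, ?_, ?_, ?_⟩, by omega⟩
      · rcases (key a).mp h1 with rfl | rfl <;> exact ⟨by omega, by decide⟩
      · rcases (key b).mp h2 with rfl | rfl <;> exact ⟨by omega, by decide⟩
      · rcases (key c).mp h3 with rfl | rfl <;> exact ⟨by omega, by decide⟩
      · rcases (key d).mp h4 with rfl | rfl <;> exact ⟨by omega, by decide⟩
  rw [this]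
  rfl

lemma divSum_four {R : ℤ} (hR : 4 ≤ R) : divSum R 4 = 1 := by
  have : (Finset.Icc 1 R ×ˢ Finset.Icc 1 R).filter (fun p : ℤ × ℤ => 4 * (p.1 * p.2) = 4) =
      {(1, 1)} := by
    ext ⟨a, b⟩
    simp only [Finset.mem_product, Finset.mem_filter, Finset.mem_Icc, Finset.mem_singleton,
      Prod.mk.injEq]
    constructor
    · rintro ⟨⟨h1, h2⟩, h⟩
      constructor <;> nlinarith
    · rintro ⟨rfl, rfl⟩
      omega
  rw [divSum, this, Finset.sum_singleton]

/-- Jacobi's theorem for sums of four odd squares. -/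
theorem card_oddRep (R : ℤ) (k : ℕ) (hR : 8 * (k : ℤ) + 5 ≤ R) :
    ((oddRep R (8 * k + 4)).card : ℤ) = 16 * divSum R (8 * k + 4) := by
  induction k using Nat.strong_induction_on with
  | _ k ih =>
    rcases Nat.eq_zero_or_pos k with rfl | hk
    · have h := card_oddRep_four (R := R) (by simp at hR; omega)
      have h' := divSum_four (R := R) (by simp at hR; omega)
      simp [h, h']
    set c : ℤ → ℤ := fun x => (8 * (k : ℤ) + 5 - 5 * x ^ 2) *
      (((oddRep R (8 * k + 5 - x ^ 2)).card : ℤ) - 16 * divSum R (8 * k + 5 - x ^ 2)) with hc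
    have hsum : ∑ x ∈ oddIcc R, c x = 0 := by
      have h1 := sum_oddRep R (8 * k + 5)
      have h2 := sum_divSum R k hR
      have : ∀ x, c x = (8 * (k : ℤ) + 5 - 5 * x ^ 2) * ((oddRep R (8 * k + 5 - x ^ 2)).card : ℤ)
          - 16 * ((8 * (k : ℤ) + 5 - 5 * x ^ 2) * divSum R (8 * k + 5 - x ^ 2)) := fun x => by
        simp only [hc]; ring
      simp only [this, Finset.sum_sub_distrib, ← Finset.mul_sum, h1, h2]
      simp
    have hsub : ({-1, 1} : Finset ℤ) ⊆ oddIcc R := by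
      intro x hx
      simp only [Finset.mem_insert, Finset.mem_singleton] at hx
      simp only [oddIcc, Finset.mem_filter, Finset.mem_Icc]
      rcases hx with rfl | rfl <;> exact ⟨by omega, by decide⟩
    have hzero : ∀ x ∈ oddIcc R, x ∉ ({-1, 1} : Finset ℤ) → c x = 0 := by
      intro x hx hx'
      simp only [oddIcc, Finset.mem_filter, Finset.mem_Icc] at hx
      simp only [Finset.mem_insert, Finset.mem_singleton] at hx'
      obtain ⟨y, rfl⟩ := hx.2
      obtain ⟨z, hz⟩ := Int.even_mul_succ_self y
      have hz1 : 1 ≤ z := by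
        have : 0 < y * (y + 1) := by
          rcases lt_or_ge y 0 with h | h
          · nlinarith [show y ≤ -2 by omega]
          · nlinarith [show 1 ≤ y by omega]
        omega
      have e : 8 * (k : ℤ) + 5 - (2 * y + 1) ^ 2 = 8 * (k - z) + 4 := by nlinarith
      simp only [hc]
      rw [e]
      rcases lt_or_ge (k : ℤ) z with h | h
      · rw [oddRep_eq_empty (by omega), divSum_eq_zero (by omega)]
        simp
      · have h3 := ih (k - z.toNat) (by omega) (by omega)
        have e2 : ((k - z.toNat : ℕ) : ℤ) = k - z := by omega
        rw [e2] at h3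
        rw [h3]
        ring
    rw [← Finset.sum_subset hsub hzero, Finset.sum_pair (by norm_num)] at hsum
    have e1 : 8 * (k : ℤ) + 5 - (-1) ^ 2 = 8 * k + 4 := by ring
    have e2 : 8 * (k : ℤ) + 5 - 1 ^ 2 = 8 * k + 4 := by ring
    simp only [hc, e1, e2] at hsum
    have : (8 * (k : ℤ)) *
      (((oddRep R (8 * k + 4)).card : ℤ) - 16 * divSum R (8 * k + 4)) = 0 := by linarith
    rcases mul_eq_zero.mp this with h | h
    · omega
    · omega

/-- Representations of `n` as a sum of four squares of integers at most `R`. -/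
def fourRep (R n : ℤ) : Finset (ℤ × ℤ × ℤ × ℤ) :=
  (Finset.Icc (-R) R ×ˢ Finset.Icc (-R) R ×ˢ Finset.Icc (-R) R ×ˢ Finset.Icc (-R) R).filter
    fun p => p.1 ^ 2 + p.2.1 ^ 2 + p.2.2.1 ^ 2 + p.2.2.2 ^ 2 = n

/-- An odd number `u` has at least `8u` representations as a sum of four squares. -/
theorem le_card_fourRep (k : ℕ) {R : ℤ} (hR : 2 * (k : ℤ) + 1 ≤ R) :
    8 * (2 * (k : ℤ) + 1) ≤ (fourRep R (2 * k + 1)).card := by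
  set R' : ℤ := 8 * k + 5
  set S := oddRep R' (8 * k + 4) with hS
  have h1 : 16 * (2 * (k : ℤ) + 1) ≤ S.card := by
    rw [hS, card_oddRep R' k le_rfl]
    have : 2 * (k : ℤ) + 1 ≤ divSum R' (8 * k + 4) := by
      refine Finset.single_le_sum (f := fun p : ℤ × ℤ => p.1) (a := ((2 * (k : ℤ) + 1), (1 : ℤ)))
        ?_ ?_
      · intro p hp
        simp only [Finset.mem_product, Finset.mem_filter, Finset.mem_Icc] at hp
        omega
      · simp only [Finset.mem_product, Finset.mem_filter, Finset.mem_Icc, R']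
        omega
    omega
  have hmem : ∀ {a b c e : ℤ}, (a, b, c, e) ∈ S → Odd a ∧ Odd b ∧ Odd c ∧ Odd e ∧
      a ^ 2 + b ^ 2 + c ^ 2 + e ^ 2 = 8 * k + 4 := by
    intro a b c e h
    simp only [hS, oddRep, oddIcc, Finset.mem_product, Finset.mem_filter] at h
    tauto
  set S0 := S.filter fun p => 4 ∣ p.1 + p.2.1 + p.2.2.1 + p.2.2.2 with hS0
  have h2 : S.card ≤ 2 * S0.card := by
    rw [← Finset.card_filter_add_card_filter_not (s := S)
      (fun p => 4 ∣ p.1 + p.2.1 + p.2.2.1 + p.2.2.2), two_mul]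
    refine Nat.add_le_add_left ?_ _
    refine Finset.card_le_card_of_injOn (fun p => (p.1, p.2.1, p.2.2.1, -p.2.2.2)) ?_ ?_
    · rintro ⟨a, b, c, e⟩ h
      simp only [Finset.coe_filter, Set.mem_ofPred_eq] at h
      have h' := hmem h.1
      obtain ⟨⟨a, rfl⟩, ⟨b, rfl⟩, ⟨c, rfl⟩, ⟨e, rfl⟩, _⟩ := h'
      simp only [hS0, Finset.coe_filter, Set.mem_ofPred_eq]
      refine ⟨?_, by omega⟩
      have h3 := h.1
      simp only [hS, oddRep, oddIcc, Finset.mem_product, Finset.mem_filter, Finset.mem_Icc] at h3 ⊢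
      refine ⟨⟨h3.1.1, h3.1.2.1, h3.1.2.2.1, ⟨by omega, by omega⟩, h3.1.2.2.2.2.neg⟩, ?_⟩
      rw [neg_sq]
      exact h3.2
    · rintro ⟨a, b, c, e⟩ _ ⟨a', b', c', e'⟩ _ h
      simpa using h
  have h3 : S0.card ≤ (fourRep R (2 * k + 1)).card := by
    refine Finset.card_le_card_of_injOn (fun p =>
      ((p.1 + p.2.1 + p.2.2.1 + p.2.2.2) / 4, (p.1 + p.2.1 - p.2.2.1 - p.2.2.2) / 4,
        (p.1 - p.2.1 + p.2.2.1 - p.2.2.2) / 4, (p.1 - p.2.1 - p.2.2.1 + p.2.2.2) / 4)) ?_ ?_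
    · rintro ⟨a, b, c, e⟩ h
      simp only [hS0, Finset.coe_filter, Set.mem_ofPred_eq] at h
      obtain ⟨⟨a, rfl⟩, ⟨b, rfl⟩, ⟨c, rfl⟩, ⟨e, rfl⟩, h4⟩ := hmem h.1
      obtain ⟨w, hw⟩ := h.2
      obtain ⟨x, hx⟩ : (4 : ℤ) ∣ 2 * a + 1 + (2 * b + 1) - (2 * c + 1) - (2 * e + 1) := by omega
      obtain ⟨y, hy⟩ : (4 : ℤ) ∣ 2 * a + 1 - (2 * b + 1) + (2 * c + 1) - (2 * e + 1) := by omega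
      obtain ⟨z, hz⟩ : (4 : ℤ) ∣ 2 * a + 1 - (2 * b + 1) - (2 * c + 1) + (2 * e + 1) := by omega
      simp only [fourRep, Finset.coe_filter, Set.mem_ofPred_eq, Finset.mem_product, Finset.mem_Icc]
      rw [hw, hx, hy, hz]
      simp only [Int.mul_ediv_cancel_left _ (show (4 : ℤ) ≠ 0 by norm_num)]
      have ha : 2 * a + 1 = w + x + y + z := by omega
      have hb : 2 * b + 1 = w + x - y - z := by omega
      have hc : 2 * c + 1 = w - x + y - z := by omega
      have he : 2 * e + 1 = w - x - y + z := by omega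
      rw [ha, hb, hc, he] at h4
      have h5 : w ^ 2 + x ^ 2 + y ^ 2 + z ^ 2 = 2 * k + 1 := by linarith
      refine ⟨⟨⟨?_, ?_⟩, ⟨?_, ?_⟩, ⟨?_, ?_⟩, ?_, ?_⟩, h5⟩ <;>
        linarith [Int.le_self_sq w, Int.le_self_sq x, Int.le_self_sq y, Int.le_self_sq z,
          Int.le_self_sq (-w), Int.le_self_sq (-x), Int.le_self_sq (-y), Int.le_self_sq (-z),
          neg_sq w, neg_sq x, neg_sq y, neg_sq z, sq_nonneg w, sq_nonneg x, sq_nonneg y,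
          sq_nonneg z]
    · rintro ⟨a, b, c, e⟩ h ⟨a', b', c', e'⟩ h' heq
      simp only [hS0, Finset.coe_filter, Set.mem_ofPred_eq] at h h'
      obtain ⟨⟨a, rfl⟩, ⟨b, rfl⟩, ⟨c, rfl⟩, ⟨e, rfl⟩, _⟩ := hmem h.1
      obtain ⟨⟨a', rfl⟩, ⟨b', rfl⟩, ⟨c', rfl⟩, ⟨e', rfl⟩, _⟩ := hmem h'.1
      have h6 := h.2
      have h7 := h'.2
      simp only [Prod.mk.injEq] at heq ⊢
      omega
  omega

/-- The cube of side `2M` centred at the origin of `ℤ^d`. -/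
def cube (d : ℕ) (M : ℤ) : Finset (V d) := Fintype.piFinset fun _ => Finset.Icc (-M) M

lemma mem_cube {d : ℕ} {M : ℤ} {u : V d} : u ∈ cube d M ↔ ∀ i, -M ≤ u i ∧ u i ≤ M := by
  simp [cube, Fintype.mem_piFinset]

lemma mem_cube_of_mem_sph {d lam : ℕ} {M : ℤ} (hM : (lam : ℤ) < (M + 1) ^ 2) (hM0 : 0 ≤ M)
    {p : V d × V d} (hp : p ∈ sph d lam) : p.1 ∈ cube d M ∧ p.2 ∈ cube d M := by
  have hp' : (∑ i, p.1 i ^ 2) + (∑ i, p.2 i ^ 2) = (lam : ℤ) := hp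
  have h1 : 0 ≤ ∑ i, p.1 i ^ 2 := Finset.sum_nonneg fun i _ => sq_nonneg _
  have h2 : 0 ≤ ∑ i, p.2 i ^ 2 := Finset.sum_nonneg fun i _ => sq_nonneg _
  have key : ∀ w : V d, ∑ i, w i ^ 2 ≤ lam → w ∈ cube d M := by
    intro w hw
    refine mem_cube.mpr fun i => ?_
    have h3 : w i ^ 2 ≤ ∑ i, w i ^ 2 :=
      Finset.single_le_sum (f := fun i => w i ^ 2) (fun i _ => sq_nonneg _) (Finset.mem_univ i)
    have := abs_lt_of_sq_lt_sq (lt_of_le_of_lt (h3.trans hw) hM) (by omega)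
    rw [abs_lt] at this
    omega
  exact ⟨key _ (by linarith), key _ (by linarith)⟩

lemma Ncount_eq_card {d lam : ℕ} {M : ℤ} (hM : (lam : ℤ) < (M + 1) ^ 2) (hM0 : 0 ≤ M) :
    Ncount d lam = ((cube d M ×ˢ cube d M).filter fun p : V d × V d =>
      (∑ i, p.1 i ^ 2) + (∑ i, p.2 i ^ 2) = (lam : ℤ)).card := by
  rw [Ncount, ← Nat.card_eq_finsetCard]
  refine Nat.card_congr (Equiv.subtypeEquivRight fun p => ?_)
  rw [Finset.mem_filter, Finset.mem_product]
  exact ⟨fun h => ⟨mem_cube_of_mem_sph hM hM0 h, h⟩, fun h => h.2⟩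

lemma finite_sph (d lam : ℕ) : (sph d lam).Finite := by
  refine Set.Finite.subset (cube d lam ×ˢ cube d lam).finite_toSet fun p hp => ?_
  rw [Finset.mem_coe, Finset.mem_product]
  exact mem_cube_of_mem_sph (by nlinarith) (by omega) hp

lemma card_le_Ncount {d lam : ℕ} {α : Type*} (s : Finset α) (g : α → V d × V d)
    (hg : ∀ a ∈ s, g a ∈ sph d lam) (hinj : Set.InjOn g s) : s.card ≤ Ncount d lam := by
  have : Finite (sph d lam) := finite_sph d lam
  have h := Nat.card_le_card_of_injective (fun a : s => (⟨g a, hg a a.2⟩ : sph d lam))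
    (fun a b h => Subtype.ext (hinj a.2 b.2 (congrArg Subtype.val h)))
  rwa [Nat.card_eq_finsetCard] at h

/-- The map assembling a four-tuple and two shorter vectors into a point of `ℤ^d × ℤ^d`. -/
def consPair {e : ℕ} (w : V e × V e) (p : ℤ × ℤ × ℤ × ℤ) : V (e + 2) × V (e + 2) :=
  (Fin.cons p.1 (Fin.cons p.2.1 w.1), Fin.cons p.2.2.1 (Fin.cons p.2.2.2 w.2))

lemma consPair_mem_sph {e lam : ℕ} {w : V e × V e} {p : ℤ × ℤ × ℤ × ℤ}
    (h : p.1 ^ 2 + p.2.1 ^ 2 + p.2.2.1 ^ 2 + p.2.2.2 ^ 2 =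
      lam - ((∑ i, w.1 i ^ 2) + ∑ i, w.2 i ^ 2)) : consPair w p ∈ sph (e + 2) lam := by
  simp only [sph, consPair, Set.mem_ofPred_eq, Fin.sum_univ_succ, Fin.cons_zero, Fin.cons_succ]
  linarith

lemma consPair_inj {e : ℕ} {w w' : V e × V e} {p p' : ℤ × ℤ × ℤ × ℤ}
    (h : consPair w p = consPair w' p') : w = w' ∧ p = p' := by
  obtain ⟨w1, w2⟩ := w
  obtain ⟨w1', w2'⟩ := w'
  obtain ⟨a, b, c, d⟩ := p
  obtain ⟨a', b', c', d'⟩ := p'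
  simp only [consPair, Prod.mk.injEq, Fin.cons_inj] at h ⊢
  tauto

/-- Vectors with coordinates in `[0, 2K)` of parity `ε` in the first coordinate and even in the
remaining ones. -/
def parityBox (e K : ℕ) (ε : ℤ) : Finset (V (e + 1)) :=
  Fintype.piFinset fun i => (Finset.range K).image fun k : ℕ => 2 * (k : ℤ) + if i = 0 then ε else 0

lemma card_parityBox (e K : ℕ) (ε : ℤ) : (parityBox e K ε).card = K ^ (e + 1) := by
  rw [parityBox, Fintype.card_piFinset]
  have : ∀ i : Fin (e + 1), ((Finset.range K).image fun k : ℕ =>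
      2 * (k : ℤ) + if i = 0 then ε else 0).card = K := fun i => by
    rw [Finset.card_image_of_injective, Finset.card_range]
    intro a b h
    simp only at h
    omega
  simp [this]

lemma parityBox_spec {e K : ℕ} {ε : ℤ} (h0 : 0 ≤ ε) (h1 : ε ≤ 1) {w : V (e + 1)}
    (hw : w ∈ parityBox e K ε) :
    ∑ i, w i ^ 2 ≤ (e + 1) * (2 * K) ^ 2 ∧ (2 : ℤ) ∣ ∑ i, w i ^ 2 - ε := by
  simp only [parityBox, Fintype.mem_piFinset, Finset.mem_image, Finset.mem_range] at hw
  constructor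
  · have : ∀ i ∈ Finset.univ, w i ^ 2 ≤ (2 * (K : ℤ)) ^ 2 := by
      intro i _
      obtain ⟨k, hk, h⟩ := hw i
      rw [← h]
      split_ifs <;> nlinarith
    have h := Finset.sum_le_card_nsmul _ _ _ this
    simpa using h
  · have h2 : ∀ x : ℤ, (2 : ℤ) ∣ x ^ 2 - x := fun x => by
      have := (Int.even_mul_pred_self x).two_dvd
      rwa [mul_sub_one, ← sq] at this
    rw [Fin.sum_univ_succ]
    have h3 : (2 : ℤ) ∣ ∑ i : Fin e, w i.succ ^ 2 := by
      refine Finset.dvd_sum fun i _ => ?_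
      obtain ⟨k, hk, h⟩ := hw i.succ
      rw [← h, if_neg (Fin.succ_ne_zero i), add_zero, mul_pow]
      exact ⟨2 * k ^ 2, by ring⟩
    obtain ⟨k, hk, h⟩ := hw 0
    rw [if_pos rfl] at h
    have h4 := h2 (w 0)
    omega

lemma le_Ncount (e K lam : ℕ) (h : 4 * (e + 1) * (2 * K) ^ 2 ≤ lam) :
    K ^ (2 * (e + 1)) * (4 * lam) ≤ Ncount (e + 3) lam := by
  set ε : ℤ := ((lam + 1 : ℕ) : ℤ) % 2 with hε
  set W := parityBox e K ε ×ˢ parityBox e K 0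
  have hW : W.card = K ^ (2 * (e + 1)) := by
    rw [Finset.card_product, card_parityBox, card_parityBox, ← pow_add, two_mul]
  set m : V (e + 1) × V (e + 1) → ℤ := fun w => lam - ((∑ i, w.1 i ^ 2) + ∑ i, w.2 i ^ 2) with hm
  have hQ : ∀ w ∈ W, 4 * lam ≤ (fourRep lam (m w)).card := by
    intro w hw
    obtain ⟨h1, h2⟩ := Finset.mem_product.mp hw
    obtain ⟨h3, h4⟩ := parityBox_spec (by omega) (by omega) h1
    obtain ⟨h5, h6⟩ := parityBox_spec (by omega) (by omega) h2
    have h7 : 0 ≤ ∑ i, w.1 i ^ 2 := Finset.sum_nonneg fun i _ => sq_nonneg _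
    have h8 : 0 ≤ ∑ i, w.2 i ^ 2 := Finset.sum_nonneg fun i _ => sq_nonneg _
    have h9 : 4 * (((e : ℤ) + 1) * (2 * K) ^ 2) ≤ lam := by
      rw [← mul_assoc]; exact_mod_cast h
    have h10 : (lam : ℤ) ≤ 2 * m w := by simp only [hm]; linarith
    have h11 : m w ≤ lam := by simp only [hm]; linarith
    have h12 : m w % 2 = 1 := by simp only [hm]; omega
    obtain ⟨k, hk⟩ : ∃ k : ℕ, m w = 2 * k + 1 := ⟨(m w / 2).toNat, by omega⟩
    have := le_card_fourRep k (R := lam) (by omega)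
    rw [hk]
    omega
  calc K ^ (2 * (e + 1)) * (4 * lam) ≤ ∑ w ∈ W, (fourRep lam (m w)).card := by
        rw [← hW, ← smul_eq_mul]
        exact Finset.card_nsmul_le_sum _ _ _ hQ
    _ = (W.sigma fun w => fourRep lam (m w)).card := (Finset.card_sigma _ _).symm
    _ ≤ Ncount (e + 3) lam := by
        refine card_le_Ncount _ (fun a => consPair a.1 a.2) ?_ ?_
        · rintro ⟨w, p⟩ ha
          exact consPair_mem_sph (Finset.mem_filter.mp (Finset.mem_sigma.mp ha).2).2
        · rintro ⟨w, p⟩ _ ⟨w', p'⟩ _ h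
          obtain ⟨rfl, rfl⟩ := consPair_inj h
          rfl

lemma one_le_Ncount (e lam : ℕ) : 1 ≤ Ncount (e + 2) lam := by
  obtain ⟨a, b, c, d, h⟩ := Nat.sum_four_squares lam
  have := card_le_Ncount (d := e + 2) (lam := lam) {()}
    (fun _ => consPair (0, 0) ((a : ℤ), (b : ℤ), (c : ℤ), (d : ℤ))) ?_ ?_
  · simpa using this
  · intro _ _
    refine consPair_mem_sph ?_
    simp only [Pi.zero_apply]
    norm_num
    exact_mod_cast h
  · intro x _ y _ _
    rfl

/-- The number of representations of `λ` as a sum of `2d ≥ 6` squares is `≫ λ ^ (d - 1)`. -/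
lemma pow_le_mul_Ncount (e lam : ℕ) :
    lam ^ (e + 2) ≤ (64 * (e + 1)) ^ (e + 2) * Ncount (e + 3) lam := by
  set D := 16 * (e + 1) with hD
  set K := Nat.sqrt (lam / D) with hK
  rcases Nat.lt_or_ge lam D with h | h
  · calc lam ^ (e + 2) ≤ (64 * (e + 1)) ^ (e + 2) := Nat.pow_le_pow_left (by omega) _
      _ ≤ _ := Nat.le_mul_of_pos_right _ (one_le_Ncount (e + 1) lam)
  have h1 : K ^ 2 ≤ lam / D := Nat.sqrt_le' _
  have h2 : lam / D < (K + 1) ^ 2 := Nat.lt_succ_sqrt' _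
  have hD0 : 0 < D := by omega
  have h3 : 1 ≤ lam / D := Nat.div_pos h hD0
  have h4 : 1 ≤ K := by
    by_contra h0
    have : K = 0 := by omega
    rw [this] at h2
    omega
  have h5 : D * K ^ 2 ≤ lam := by
    calc D * K ^ 2 ≤ D * (lam / D) := Nat.mul_le_mul_left _ h1
      _ ≤ lam := Nat.mul_div_le _ _
  have h6 : lam ≤ 4 * D * K ^ 2 := by
    have : lam < D * (K + 1) ^ 2 := by
      have := Nat.lt_mul_of_div_lt h2 hD0
      rwa [mul_comm] at this
    nlinarith
  have h7 := le_Ncount e K lam (by rw [hD] at h5; nlinarith)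
  calc lam ^ (e + 2) = lam ^ (e + 1) * lam := pow_succ _ _
    _ ≤ (4 * D * K ^ 2) ^ (e + 1) * lam := Nat.mul_le_mul_right _ (Nat.pow_le_pow_left h6 _)
    _ = (64 * (e + 1)) ^ (e + 1) * (K ^ (2 * (e + 1)) * lam) := by
        rw [hD, pow_mul, show 4 * (16 * (e + 1)) * K ^ 2 = (64 * (e + 1)) * K ^ 2 by ring, mul_pow,
          mul_assoc]
    _ ≤ (64 * (e + 1)) ^ (e + 2) * Ncount (e + 3) lam := by
        refine Nat.mul_le_mul (Nat.pow_le_pow_right (by omega) (by omega)) ?_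
        refine le_trans ?_ h7
        exact Nat.mul_le_mul_left _ (by omega)

lemma mul_card_le_of_dvd_sub {M m : ℕ} {S : Finset ℤ} (hS : S ⊆ Finset.Icc (-(M : ℤ)) M)
    (h : ∀ x ∈ S, ∀ y ∈ S, (m : ℤ) ∣ x - y) : m * S.card ≤ 2 * M + m := by
  have h1 : (S ×ˢ Finset.range m).card ≤ (Finset.Icc (-(M : ℤ)) (M + m - 1)).card := by
    refine Finset.card_le_card_of_injOn (fun p => p.1 + (p.2 : ℤ)) ?_ ?_
    · rintro ⟨b, i⟩ hp
      obtain ⟨hb, hi⟩ := Finset.mem_product.mp (Finset.mem_coe.mp hp)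
      have := Finset.mem_Icc.mp (hS hb)
      have := Finset.mem_range.mp hi
      simp only [Finset.coe_Icc, Set.mem_Icc] at *
      omega
    · rintro ⟨b, i⟩ hp ⟨b', i'⟩ hp' heq
      obtain ⟨hb, hi⟩ := Finset.mem_product.mp (Finset.mem_coe.mp hp)
      obtain ⟨hb', hi'⟩ := Finset.mem_product.mp (Finset.mem_coe.mp hp')
      have := Finset.mem_range.mp hi
      have := Finset.mem_range.mp hi'
      simp only at *
      have hd : (m : ℤ) ∣ i' - i := by
        have := h b hb b' hb'
        rwa [show b - b' = (i' : ℤ) - i by linarith] at this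
      have := Int.eq_zero_of_abs_lt_dvd hd (by rw [abs_lt]; omega)
      simp only [Prod.mk.injEq]
      omega
  rw [Finset.card_product, Finset.card_range, Int.card_Icc] at h1
  have : (((M : ℤ) + m - 1 + 1 - -(M : ℤ))).toNat = 2 * M + m := by omega
  rw [this] at h1
  linarith

/-- The discrete cube of side `2M` in `ℤ³`. -/
def cubeThree (M : ℕ) : Finset (ℤ × ℤ × ℤ) :=
  Finset.Icc (-(M : ℤ)) M ×ˢ Finset.Icc (-(M : ℤ)) M ×ˢ Finset.Icc (-(M : ℤ)) M

/-- The scalar product on `ℤ³`. -/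
def dotThree (a b : ℤ × ℤ × ℤ) : ℤ := a.1 * b.1 + a.2.1 * b.2.1 + a.2.2 * b.2.2

/-- Points of a cube in an affine plane of `ℤ³`. -/
lemma card_plane_le {a : ℤ × ℤ × ℤ} {M : ℕ} (c : ℤ) (h0 : a.2.2 ≠ 0) (hM : a.2.2.natAbs ≤ M) :
    a.2.2.natAbs * ((cubeThree M).filter fun b => dotThree a b = c).card ≤
      9 * M ^ 2 * Int.gcd a.2.1 (Int.gcd a.1 a.2.2) := by
  obtain ⟨a1, a2, a3⟩ := a
  simp only at h0 hM ⊢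
  set T := (cubeThree M).filter fun b => dotThree (a1, a2, a3) b = c with hT
  have hTmem : ∀ {b : ℤ × ℤ × ℤ}, b ∈ T → b.1 ∈ Finset.Icc (-(M : ℤ)) M ∧
      b.2.1 ∈ Finset.Icc (-(M : ℤ)) M ∧ a1 * b.1 + a2 * b.2.1 + a3 * b.2.2 = c := by
    intro b hb
    rw [hT, Finset.mem_filter] at hb
    simp only [cubeThree, dotThree, Finset.mem_product] at hb
    exact ⟨hb.1.1, hb.1.2.1, hb.2⟩
  set h := Int.gcd a1 a3 with hh
  have hpos : 0 < h := Int.gcd_pos_of_ne_zero_right _ h0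
  obtain ⟨α, β, hαβ, hα, hβ⟩ := Int.exists_gcd_one (m := a1) (n := a3) hpos
  set g := Int.gcd a2 h with hg
  have hgpos : 0 < g := Int.gcd_pos_of_ne_zero_right _ (by omega)
  obtain ⟨γ, δ, hγδ, hγ, hδ⟩ := Int.exists_gcd_one (m := a2) (n := (h : ℤ)) hgpos
  rw [← hh] at hα hβ
  rw [← hg] at hγ hδ
  have hA : a3.natAbs = β.natAbs * (δ.natAbs * g) := by
    have : h = δ.natAbs * g := by
      have := congrArg Int.natAbs hδ
      simpa [Int.natAbs_mul] using this
    rw [← this, hβ, Int.natAbs_mul, Int.natAbs_natCast]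
  have hβ0 : 0 < β.natAbs := Nat.pos_of_ne_zero fun h' => by simp [h'] at hA; exact h0 hA
  have hδ0 : 0 < δ.natAbs := Nat.pos_of_ne_zero fun h' => by simp [h'] at hA; exact h0 hA
  have hβM : β.natAbs ≤ M := le_trans (by rw [hA]; exact Nat.le_mul_of_pos_right _ (by positivity)) hM
  have hδM : δ.natAbs ≤ M :=
    le_trans (by rw [hA]; calc
      δ.natAbs ≤ δ.natAbs * g := Nat.le_mul_of_pos_right _ hgpos
      _ ≤ _ := Nat.le_mul_of_pos_left _ hβ0) hM
  have hfib : ∀ y ∈ T.image (fun b => b.2.1),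
      (T.filter fun b => b.2.1 = y).card ≤ 3 * M / β.natAbs := by
    intro y _
    rw [Nat.le_div_iff_mul_le hβ0, mul_comm]
    set U := T.filter fun b => b.2.1 = y with hU
    have hinj : Set.InjOn (fun b : ℤ × ℤ × ℤ => b.1) U := by
      rintro ⟨x, y1, z⟩ hb ⟨x', y2, z'⟩ hb' hx
      simp only [hU, Finset.coe_filter, Set.mem_ofPred_eq] at hb hb'
      simp only at hx
      subst hx
      have e1 := (hTmem hb.1).2.2
      have e2 := (hTmem hb'.1).2.2
      obtain ⟨_, rfl⟩ := hb
      obtain ⟨_, rfl⟩ := hb'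
      have : a3 * (z - z') = 0 := by simp only at e1 e2; linarith
      have := (mul_eq_zero.mp this).resolve_left h0
      simp only [Prod.mk.injEq, true_and]
      omega
    rw [← Finset.card_image_of_injOn hinj]
    refine (mul_card_le_of_dvd_sub (M := M) ?_ ?_).trans (by omega)
    · intro x hx
      obtain ⟨b, hb, rfl⟩ := Finset.mem_image.mp hx
      exact (hTmem (Finset.mem_filter.mp hb).1).1
    · intro x hx x' hx'
      obtain ⟨b, hb, rfl⟩ := Finset.mem_image.mp hx
      obtain ⟨b', hb', rfl⟩ := Finset.mem_image.mp hx'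
      obtain ⟨hb1, hb2⟩ := Finset.mem_filter.mp hb
      obtain ⟨hb1', hb2'⟩ := Finset.mem_filter.mp hb'
      have e1 := (hTmem hb1).2.2
      have e2 := (hTmem hb1').2.2
      rw [hb2, hα, hβ] at e1
      rw [hb2', hα, hβ] at e2
      have e3 : (h : ℤ) * (α * (b.1 - b'.1) + β * (b.2.2 - b'.2.2)) = 0 := by linarith
      have e4 := (mul_eq_zero.mp e3).resolve_left (by omega)
      rw [Int.natAbs_dvd]
      refine Int.dvd_of_dvd_mul_right_of_gcd_one (b := α) ⟨-(b.2.2 - b'.2.2), by linarith⟩ ?_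
      rwa [Int.gcd_comm]
  have hbase : δ.natAbs * (T.image fun b => b.2.1).card ≤ 3 * M := by
    refine (mul_card_le_of_dvd_sub (M := M) ?_ ?_).trans (by omega)
    · intro x hx
      obtain ⟨b, hb, rfl⟩ := Finset.mem_image.mp hx
      exact (hTmem hb).2.1
    · intro x hx x' hx'
      obtain ⟨b, hb, rfl⟩ := Finset.mem_image.mp hx
      obtain ⟨b', hb', rfl⟩ := Finset.mem_image.mp hx'
      have e1 := (hTmem hb).2.2
      have e2 := (hTmem hb').2.2
      rw [hα, hβ, hδ, hγ] at e1
      rw [hα, hβ, hδ, hγ] at e2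
      have e3 : (g : ℤ) * (γ * (b.2.1 - b'.2.1) +
        δ * (α * (b.1 - b'.1) + β * (b.2.2 - b'.2.2))) = 0 := by linarith
      have e4 := (mul_eq_zero.mp e3).resolve_left (by omega)
      rw [Int.natAbs_dvd]
      refine Int.dvd_of_dvd_mul_right_of_gcd_one (b := γ)
        ⟨-(α * (b.1 - b'.1) + β * (b.2.2 - b'.2.2)), by linarith⟩ ?_
      rwa [Int.gcd_comm]
  have hcard := Finset.card_le_mul_card_image T (3 * M / β.natAbs) hfib
  have hdiv : β.natAbs * (3 * M / β.natAbs) ≤ 3 * M := Nat.mul_div_le _ _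
  calc a3.natAbs * T.card
      ≤ (β.natAbs * (δ.natAbs * g)) *
          (3 * M / β.natAbs * (T.image fun b => b.2.1).card) := by
        rw [hA]; exact Nat.mul_le_mul_left _ hcard
    _ = (β.natAbs * (3 * M / β.natAbs)) * (δ.natAbs * (T.image fun b => b.2.1).card) * g := by ring
    _ ≤ (3 * M) * (3 * M) * g := Nat.mul_le_mul_right _ (Nat.mul_le_mul hdiv hbase)
    _ = 9 * M ^ 2 * g := by ring

lemma mul_card_filter_dvd_le (M g : ℕ) (s : Finset ℤ) (hs : s ⊆ Finset.Icc (-(M : ℤ)) M) :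
    g * (s.filter fun x => (g : ℤ) ∣ x).card ≤ 2 * M + g :=
  mul_card_le_of_dvd_sub ((Finset.filter_subset _ _).trans hs) fun _ hx _ hy =>
    dvd_sub (Finset.mem_filter.mp hx).2 (Finset.mem_filter.mp hy).2

/-- Sum of greatest common divisors over a square. -/
lemma sum_gcd_le (z : ℤ) (hz : z ≠ 0) :
    ∑ p ∈ Finset.Icc (-(z.natAbs : ℤ)) z.natAbs ×ˢ Finset.Icc (-(z.natAbs : ℤ)) z.natAbs,
      Int.gcd p.2 (Int.gcd p.1 z) ≤ 9 * z.natAbs * ∑ g ∈ z.natAbs.divisors, g := by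
  set A := z.natAbs with hA
  have hA0 : A ≠ 0 := Int.natAbs_ne_zero.mpr hz
  set I := Finset.Icc (-(A : ℤ)) A
  have h1 : ∀ p ∈ I ×ˢ I, Int.gcd p.2 (Int.gcd p.1 z) ≤
      ∑ g ∈ A.divisors, if (g : ℤ) ∣ p.1 ∧ (g : ℤ) ∣ p.2 then g else 0 := by
    intro p _
    set g := Int.gcd p.2 (Int.gcd p.1 z) with hg
    have hd1 : (g : ℤ) ∣ p.2 := Int.gcd_dvd_left ..
    have hd2 : (g : ℤ) ∣ (Int.gcd p.1 z : ℤ) := Int.gcd_dvd_right ..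
    have hd3 : (g : ℤ) ∣ p.1 := hd2.trans (Int.gcd_dvd_left ..)
    have hd4 : (g : ℤ) ∣ z := hd2.trans (Int.gcd_dvd_right ..)
    have hmem : g ∈ A.divisors := Nat.mem_divisors.mpr ⟨Int.natCast_dvd.mp hd4, hA0⟩
    refine le_trans ?_ (Finset.single_le_sum (fun _ _ => Nat.zero_le _) hmem)
    rw [if_pos ⟨hd3, hd1⟩]
  refine (Finset.sum_le_sum h1).trans ?_
  rw [Finset.sum_comm, ← Nat.sum_div_divisors A (fun g => g), Finset.mul_sum]
  refine Finset.sum_le_sum fun g hg => ?_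
  obtain ⟨q, hq⟩ := (Nat.mem_divisors.mp hg).1
  have hg0 : 0 < g := Nat.pos_of_mem_divisors hg
  rw [← Finset.sum_filter, Finset.sum_const, smul_eq_mul]
  have : (I ×ˢ I).filter (fun p => (g : ℤ) ∣ p.1 ∧ (g : ℤ) ∣ p.2) =
      (I.filter fun x => (g : ℤ) ∣ x) ×ˢ (I.filter fun x => (g : ℤ) ∣ x) := by
    rw [← Finset.filter_product]
  rw [this, Finset.card_product]
  set n := (I.filter fun x => (g : ℤ) ∣ x).card with hn
  have hq0 : 1 ≤ q := Nat.pos_of_ne_zero fun h => hA0 (by rw [hq, h, mul_zero])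
  have h2 : g * n ≤ 2 * A + g := mul_card_filter_dvd_le A g I subset_rfl
  have h3 : n ≤ 3 * q := by
    refine Nat.le_of_mul_le_mul_left (h2.trans ?_) hg0
    rw [hq]; nlinarith
  rw [hq, Nat.mul_div_cancel_left _ hg0]
  calc n * n * g ≤ (3 * q) * (3 * q) * g := by gcongr
    _ = 9 * (g * q) * q := by ring

/-- The sum of `σ` over nonzero integers of absolute value at most `M`. -/
lemma sum_sum_divisors_le (M : ℕ) :
    ∑ z ∈ (Finset.Icc (-(M : ℤ)) M).filter (· ≠ 0), ∑ g ∈ z.natAbs.divisors, g ≤ 3 * M ^ 2 := by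
  set Z := (Finset.Icc (-(M : ℤ)) M).filter (· ≠ 0) with hZ
  have h1 : ∀ z ∈ Z, ∑ g ∈ z.natAbs.divisors, g ≤
      ∑ g ∈ Finset.Icc 1 M, if (g : ℤ) ∣ z then g else 0 := by
    intro z hz
    rw [hZ, Finset.mem_filter, Finset.mem_Icc] at hz
    rw [← Finset.sum_filter]
    refine Finset.sum_le_sum_of_subset fun g hg => ?_
    have h1 := Nat.divisor_le hg
    have h2 := Nat.pos_of_mem_divisors hg
    rw [Finset.mem_filter, Finset.mem_Icc]
    exact ⟨by omega, Int.natCast_dvd.mpr (Nat.mem_divisors.mp hg).1⟩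
  refine (Finset.sum_le_sum h1).trans ?_
  rw [Finset.sum_comm]
  calc ∑ g ∈ Finset.Icc 1 M, ∑ z ∈ Z, (if (g : ℤ) ∣ z then g else 0)
      ≤ ∑ g ∈ Finset.Icc 1 M, 3 * M := by
        refine Finset.sum_le_sum fun g hg => ?_
        rw [← Finset.sum_filter, Finset.sum_const, smul_eq_mul, mul_comm]
        have := mul_card_filter_dvd_le M g Z (Finset.filter_subset _ _)
        have := (Finset.mem_Icc.mp hg).2
        omega
    _ = 3 * M ^ 2 := by simp; ring

lemma card_dotThree_eq_of_max_le (M : ℕ) (c : ℤ) :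
    ((cubeThree M ×ˢ cubeThree M).filter fun p => dotThree p.1 p.2 = c ∧ p.1.2.2 ≠ 0 ∧
      p.1.1.natAbs ≤ p.1.2.2.natAbs ∧ p.1.2.1.natAbs ≤ p.1.2.2.natAbs).card ≤ 243 * M ^ 4 := by
  set Z := (Finset.Icc (-(M : ℤ)) M).filter (· ≠ 0) with hZ
  set I : ℤ → Finset ℤ := fun z => Finset.Icc (-(z.natAbs : ℤ)) z.natAbs with hI
  set B : ℤ × ℤ × ℤ → Finset (ℤ × ℤ × ℤ) := fun a => (cubeThree M).filter fun b => dotThree a b = c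
    with hB
  have h1 : ((cubeThree M ×ˢ cubeThree M).filter fun p => dotThree p.1 p.2 = c ∧ p.1.2.2 ≠ 0 ∧
      p.1.1.natAbs ≤ p.1.2.2.natAbs ∧ p.1.2.1.natAbs ≤ p.1.2.2.natAbs).card ≤
      (Z.sigma fun z => (I z ×ˢ I z).sigma fun q => B (q.1, q.2, z)).card := by
    refine Finset.card_le_card_of_injOn (fun p => ⟨p.1.2.2, (p.1.1, p.1.2.1), p.2⟩) ?_ ?_
    · rintro ⟨⟨a1, a2, a3⟩, b⟩ h
      simp only [cubeThree, Finset.coe_filter, Set.mem_ofPred_eq, Finset.mem_product,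
        Finset.mem_Icc, Finset.coe_sigma, Set.mem_sigma_iff, Finset.mem_coe, hZ,
        hI, hB] at h ⊢
      obtain ⟨⟨⟨h1, h2, h3⟩, h4⟩, h5, h6, h7, h8⟩ := h
      exact ⟨⟨h3, h6⟩, by omega, h4, h5⟩
    · rintro ⟨⟨a1, a2, a3⟩, b⟩ _ ⟨⟨a1', a2', a3'⟩, b'⟩ _ h
      simp only [Sigma.mk.injEq] at h
      obtain ⟨rfl, h⟩ := h
      simp only [heq_eq_eq, Sigma.mk.injEq, Prod.mk.injEq] at h
      obtain ⟨⟨rfl, rfl⟩, rfl⟩ := h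
      rfl
  refine h1.trans ?_
  rw [Finset.card_sigma]
  have h2 : ∀ z ∈ Z, ((I z ×ˢ I z).sigma fun q => B (q.1, q.2, z)).card ≤
      81 * M ^ 2 * ∑ g ∈ z.natAbs.divisors, g := by
    intro z hz
    rw [hZ, Finset.mem_filter, Finset.mem_Icc] at hz
    have hz0 : 0 < z.natAbs := by omega
    refine Nat.le_of_mul_le_mul_left ?_ hz0
    rw [Finset.card_sigma, Finset.mul_sum]
    calc ∑ q ∈ I z ×ˢ I z, z.natAbs * (B (q.1, q.2, z)).card
        ≤ ∑ q ∈ I z ×ˢ I z, 9 * M ^ 2 * Int.gcd q.2 (Int.gcd q.1 z) :=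
          Finset.sum_le_sum fun q _ => card_plane_le (a := (q.1, q.2, z)) c hz.2 (by simp only; omega)
      _ ≤ 9 * M ^ 2 * (9 * z.natAbs * ∑ g ∈ z.natAbs.divisors, g) := by
          rw [← Finset.mul_sum]
          exact Nat.mul_le_mul_left _ (sum_gcd_le z hz.2)
      _ = _ := by ring
  calc _ ≤ ∑ z ∈ Z, 81 * M ^ 2 * ∑ g ∈ z.natAbs.divisors, g := Finset.sum_le_sum h2
    _ ≤ 81 * M ^ 2 * (3 * M ^ 2) := by
        rw [← Finset.mul_sum]
        exact Nat.mul_le_mul_left _ (sum_sum_divisors_le M)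
    _ = 243 * M ^ 4 := by ring

/-- The number of pairs in a cube of `ℤ³` with prescribed scalar product. -/
lemma card_dotThree_eq_le (M : ℕ) (hM : 1 ≤ M) (c : ℤ) :
    ((cubeThree M ×ˢ cubeThree M).filter fun p => dotThree p.1 p.2 = c).card ≤ 756 * M ^ 4 := by
  set G := (cubeThree M ×ˢ cubeThree M).filter fun p => dotThree p.1 p.2 = c with hG
  set G3 := (cubeThree M ×ˢ cubeThree M).filter fun p => dotThree p.1 p.2 = c ∧ p.1.2.2 ≠ 0 ∧
      p.1.1.natAbs ≤ p.1.2.2.natAbs ∧ p.1.2.1.natAbs ≤ p.1.2.2.natAbs with hG3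
  have hG3c : G3.card ≤ 243 * M ^ 4 := card_dotThree_eq_of_max_le M c
  set s1 : ℤ × ℤ × ℤ → ℤ × ℤ × ℤ := fun a => (a.2.2, a.2.1, a.1) with hs1
  set s2 : ℤ × ℤ × ℤ → ℤ × ℤ × ℤ := fun a => (a.1, a.2.2, a.2.1) with hs2
  have hsub : G ⊆ ({0} ×ˢ cubeThree M) ∪ (G3 ∪ (G3.image (Prod.map s1 s1) ∪
      G3.image (Prod.map s2 s2))) := by
    rintro ⟨⟨a1, a2, a3⟩, ⟨b1, b2, b3⟩⟩ h
    rw [hG, Finset.mem_filter] at h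
    simp only [cubeThree, dotThree, Finset.mem_product] at h
    obtain ⟨⟨⟨ha1, ha2, ha3⟩, hb1, hb2, hb3⟩, hc⟩ := h
    simp only [Finset.mem_union, Finset.mem_product, Finset.mem_singleton, Finset.mem_image]
    by_cases h0 : a1 = 0 ∧ a2 = 0 ∧ a3 = 0
    · left
      obtain ⟨rfl, rfl, rfl⟩ := h0
      exact ⟨rfl, by simp only [cubeThree, Finset.mem_product]; exact ⟨hb1, hb2, hb3⟩⟩
    right
    have h3 : (a3 ≠ 0 ∧ a1.natAbs ≤ a3.natAbs ∧ a2.natAbs ≤ a3.natAbs) ∨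
        (a1 ≠ 0 ∧ a3.natAbs ≤ a1.natAbs ∧ a2.natAbs ≤ a1.natAbs) ∨
        (a2 ≠ 0 ∧ a1.natAbs ≤ a2.natAbs ∧ a3.natAbs ≤ a2.natAbs) := by omega
    rcases h3 with h3 | h3 | h3
    · left
      rw [hG3, Finset.mem_filter]
      simp only [cubeThree, dotThree, Finset.mem_product]
      exact ⟨⟨⟨ha1, ha2, ha3⟩, hb1, hb2, hb3⟩, hc, h3⟩
    · right; left
      refine ⟨((a3, a2, a1), (b3, b2, b1)), ?_, rfl⟩
      rw [hG3, Finset.mem_filter]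
      simp only [cubeThree, dotThree, Finset.mem_product]
      exact ⟨⟨⟨ha3, ha2, ha1⟩, hb3, hb2, hb1⟩, by linarith, h3⟩
    · right; right
      refine ⟨((a1, a3, a2), (b1, b3, b2)), ?_, rfl⟩
      rw [hG3, Finset.mem_filter]
      simp only [cubeThree, dotThree, Finset.mem_product]
      exact ⟨⟨⟨ha1, ha3, ha2⟩, hb1, hb3, hb2⟩, by linarith, h3⟩
  have h0 : (({0} : Finset (ℤ × ℤ × ℤ)) ×ˢ cubeThree M).card ≤ 27 * M ^ 4 := by
    rw [Finset.card_product, Finset.card_singleton, one_mul, cubeThree, Finset.card_product,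
      Finset.card_product, Int.card_Icc]
    have : ((M : ℤ) + 1 - -(M : ℤ)).toNat ≤ 3 * M := by omega
    calc _ ≤ (3 * M) * ((3 * M) * (3 * M)) := by gcongr
      _ = 27 * M ^ 3 := by ring
      _ ≤ 27 * M ^ 4 := Nat.mul_le_mul_left _ (Nat.pow_le_pow_right hM (by norm_num))
  have h4 := Finset.card_le_card hsub
  have h5 := Finset.card_union_le ({0} ×ˢ cubeThree M) (G3 ∪ (G3.image (Prod.map s1 s1) ∪
      G3.image (Prod.map s2 s2)))
  have h6 := Finset.card_union_le G3 (G3.image (Prod.map s1 s1) ∪ G3.image (Prod.map s2 s2))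
  have h7 := Finset.card_union_le (G3.image (Prod.map s1 s1)) (G3.image (Prod.map s2 s2))
  have h8 : (G3.image (Prod.map s1 s1)).card ≤ G3.card := Finset.card_image_le
  have h9 : (G3.image (Prod.map s2 s2)).card ≤ G3.card := Finset.card_image_le
  omega

/-- Cauchy–Schwarz: additive energy controls the number of representations as a sum. -/
lemma card_add_eq_le_card_eq {α : Type*} [DecidableEq α] (s : Finset α) (f : α → ℤ)
    (hf : ∀ a, 0 ≤ f a) (n : ℤ) :
    ((s ×ˢ s).filter fun p => f p.1 + f p.2 = n).card ≤
      ((s ×ˢ s).filter fun p => f p.1 = f p.2).card := by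
  set c : ℤ → ℕ := fun m => (s.filter fun a => f a = m).card with hc
  have h1 : ((s ×ˢ s).filter fun p => f p.1 + f p.2 = n).card =
      ∑ m ∈ Finset.Icc 0 n, c m * c (n - m) := by
    rw [Finset.card_eq_sum_card_fiberwise (f := fun p : α × α => f p.1) (t := Finset.Icc 0 n)]
    · refine Finset.sum_congr rfl fun m _ => ?_
      rw [hc, ← Finset.card_product]
      congr 1
      ext ⟨a, b⟩
      simp only [Finset.mem_filter, Finset.mem_product]
      constructor
      · rintro ⟨⟨⟨h1, h2⟩, h3⟩, h4⟩
        exact ⟨⟨h1, h4⟩, h2, by linarith⟩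
      · rintro ⟨⟨h1, h4⟩, h2, h3⟩
        exact ⟨⟨⟨h1, h2⟩, by linarith⟩, h4⟩
    · rintro ⟨a, b⟩ h
      simp only [Finset.coe_filter, Set.mem_ofPred_eq] at h
      have := hf a
      have := hf b
      simp only [Finset.coe_Icc, Set.mem_Icc]
      omega
  have h2 : ∑ m ∈ Finset.Icc 0 n, c m ^ 2 ≤ ((s ×ˢ s).filter fun p => f p.1 = f p.2).card := by
    have h3 : ∀ m ∈ Finset.Icc 0 n, c m ^ 2 =
        (((s ×ˢ s).filter fun p => f p.1 = f p.2).filter fun p => f p.1 = m).card := by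
      intro m _
      rw [hc, sq, ← Finset.card_product]
      congr 1
      ext ⟨a, b⟩
      simp only [Finset.mem_filter, Finset.mem_product]
      constructor
      · rintro ⟨⟨h1, h2⟩, h3, h4⟩
        exact ⟨⟨⟨h1, h3⟩, by linarith⟩, h2⟩
      · rintro ⟨⟨⟨h1, h3⟩, h4⟩, h2⟩
        exact ⟨⟨h1, h2⟩, h3, by linarith⟩
    rw [Finset.sum_congr rfl h3, ← Finset.card_biUnion]
    · exact Finset.card_le_card (Finset.biUnion_subset.mpr fun m _ => Finset.filter_subset _ _)
    · intro m _ m' _ hmm'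
      rw [Function.onFun, Finset.disjoint_left]
      intro p hp hp'
      exact hmm' ((Finset.mem_filter.mp hp).2.symm.trans (Finset.mem_filter.mp hp').2)
  have h4 : ∑ m ∈ Finset.Icc 0 n, c (n - m) ^ 2 = ∑ m ∈ Finset.Icc 0 n, c m ^ 2 := by
    refine Finset.sum_nbij' (fun m => n - m) (fun m => n - m) ?_ ?_ ?_ ?_ ?_ <;> intro m hm <;>
      simp only [Finset.mem_Icc] at * <;> omega
  have h5 : ∑ m ∈ Finset.Icc 0 n, 2 * (c m * c (n - m)) ≤
      ∑ m ∈ Finset.Icc 0 n, (c m ^ 2 + c (n - m) ^ 2) := by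
    refine Finset.sum_le_sum fun m _ => ?_
    rw [← mul_assoc]
    exact two_mul_le_add_sq _ _
  rw [← Finset.mul_sum, Finset.sum_add_distrib, h4] at h5
  rw [h1]
  omega

/-- The number of representations of `λ` as a sum of `2d ≥ 6` squares is `≪ λ ^ (d - 1)`. -/
lemma Ncount_le (e lam : ℕ) (hlam : 1 ≤ lam) :
    Ncount (e + 3) lam ≤ (6 ^ (2 * e) * (756 * 16)) * lam ^ (e + 2) := by
  set M := Nat.sqrt lam with hMdef
  have hM1 : 1 ≤ M := Nat.sqrt_pos.mpr hlam
  have hM2 : M ^ 2 ≤ lam := Nat.sqrt_le' _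
  have hM3 : lam < (M + 1) ^ 2 := Nat.lt_succ_sqrt' _
  rw [Ncount_eq_card (M := M) (by exact_mod_cast hM3) (by omega)]
  refine (card_add_eq_le_card_eq (cube (e + 3) M) (fun u => ∑ i, u i ^ 2)
    (fun u => Finset.sum_nonneg fun i _ => sq_nonneg _) lam).trans ?_
  set W := cube e (2 * M : ℕ) ×ˢ cube e (2 * M : ℕ)
  set G : V e × V e → Finset ((ℤ × ℤ × ℤ) × (ℤ × ℤ × ℤ)) := fun w =>
    (cubeThree (2 * M) ×ˢ cubeThree (2 * M)).filter fun p =>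
      dotThree p.1 p.2 = -∑ i, w.1 i * w.2 i with hG
  have h1 : ((cube (e + 3) M ×ˢ cube (e + 3) M).filter fun p : V (e + 3) × V (e + 3) =>
      ∑ i, p.1 i ^ 2 = ∑ i, p.2 i ^ 2).card ≤ (W.sigma G).card := by
    refine Finset.card_le_card_of_injOn (fun p =>
      ⟨(fun i => p.1 i.succ.succ.succ - p.2 i.succ.succ.succ,
        fun i => p.1 i.succ.succ.succ + p.2 i.succ.succ.succ),
        ((p.1 0 - p.2 0, p.1 1 - p.2 1, p.1 2 - p.2 2),
          (p.1 0 + p.2 0, p.1 1 + p.2 1, p.1 2 + p.2 2))⟩) ?_ ?_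
    · rintro ⟨u, v⟩ h
      simp only [Finset.coe_filter, Set.mem_ofPred_eq, Finset.mem_product, mem_cube] at h
      obtain ⟨⟨hu, hv⟩, h⟩ := h
      simp only [Finset.coe_sigma, Set.mem_sigma_iff, Finset.mem_coe, W, Finset.mem_product,
        mem_cube, hG, Finset.mem_filter, cubeThree, Finset.mem_Icc, dotThree]
      refine ⟨⟨fun i => ?_, fun i => ?_⟩, ?_, ?_⟩
      · have := hu i.succ.succ.succ
        have := hv i.succ.succ.succ
        push_cast
        omega
      · have := hu i.succ.succ.succ
        have := hv i.succ.succ.succ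
        push_cast
        omega
      · have := hu 0
        have := hv 0
        have := hu 1
        have := hv 1
        have := hu 2
        have := hv 2
        push_cast
        omega
      · have e1 : ∑ i, (u i - v i) * (u i + v i) = 0 := by
          have : ∀ i, (u i - v i) * (u i + v i) = u i ^ 2 - v i ^ 2 := fun i => by ring
          simp only [this, Finset.sum_sub_distrib, h, sub_self]
        rw [Fin.sum_univ_succ, Fin.sum_univ_succ, Fin.sum_univ_succ] at e1
        have h01 : (Fin.succ 0 : Fin (e + 3)) = 1 := rfl
        have h02 : (Fin.succ (Fin.succ 0) : Fin (e + 3)) = 2 := rfl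
        rw [h01, h02] at e1
        linarith
    · rintro ⟨u, v⟩ _ ⟨u', v'⟩ _ h
      simp only [Sigma.mk.injEq, Prod.mk.injEq, heq_eq_eq, funext_iff] at h
      obtain ⟨⟨h1, h2⟩, ⟨h3, h4, h5⟩, h6, h7, h8⟩ := h
      have key : ∀ i, u i = u' i ∧ v i = v' i := by
        intro i
        refine Fin.cases ?_ (fun i => ?_) i
        · omega
        refine Fin.cases ?_ (fun i => ?_) i
        · have h01 : (Fin.succ 0 : Fin (e + 3)) = 1 := rfl
          rw [h01]; omega
        refine Fin.cases ?_ (fun i => ?_) i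
        · have h02 : (Fin.succ (Fin.succ 0) : Fin (e + 3)) = 2 := rfl
          rw [h02]; omega
        have := h1 i
        have := h2 i
        omega
      exact Prod.ext (funext fun i => (key i).1) (funext fun i => (key i).2)
  refine h1.trans ?_
  have hW : W.card ≤ (6 * M) ^ (2 * e) := by
    have : (cube e (2 * M : ℕ)).card ≤ (6 * M) ^ e := by
      rw [cube, Fintype.card_piFinset_const, Int.card_Icc]
      refine Nat.pow_le_pow_left ?_ _
      push_cast
      omega
    rw [Finset.card_product, two_mul e, pow_add]
    exact Nat.mul_le_mul this this
  calc (W.sigma G).card = ∑ w ∈ W, (G w).card := Finset.card_sigma _ _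
    _ ≤ W.card * (756 * (2 * M) ^ 4) := by
        rw [← smul_eq_mul]
        exact Finset.sum_le_card_nsmul _ _ _ fun w _ => card_dotThree_eq_le _ (by omega) _
    _ ≤ (6 * M) ^ (2 * e) * (756 * (2 * M) ^ 4) := Nat.mul_le_mul_right _ hW
    _ = (6 ^ (2 * e) * (756 * 16)) * (M ^ 2) ^ (e + 2) := by
        rw [mul_pow, mul_pow, ← pow_mul, show 2 * (e + 2) = 2 * e + 4 by ring, pow_add M]
        ring
    _ ≤ _ := Nat.mul_le_mul_left _ (Nat.pow_le_pow_left hM2 _)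

/-- Sphere counts are comparable within a dyadic block. -/
lemma exists_Ncount_le (d : ℕ) (hd : 3 ≤ d) : ∃ C : ℕ, ∀ L lam : ℕ, 1 ≤ L → L ≤ lam →
    Ncount d L ≤ C * Ncount d lam := by
  obtain ⟨e, rfl⟩ : ∃ e, d = e + 3 := ⟨d - 3, by omega⟩
  refine ⟨(6 ^ (2 * e) * (756 * 16)) * (64 * (e + 1)) ^ (e + 2), fun L lam hL hlam => ?_⟩
  calc Ncount (e + 3) L ≤ (6 ^ (2 * e) * (756 * 16)) * L ^ (e + 2) := Ncount_le e L hL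
    _ ≤ (6 ^ (2 * e) * (756 * 16)) * lam ^ (e + 2) := by gcongr
    _ ≤ (6 ^ (2 * e) * (756 * 16)) * ((64 * (e + 1)) ^ (e + 2) * Ncount (e + 3) lam) :=
        Nat.mul_le_mul_left _ (pow_le_mul_Ncount e lam)
    _ = _ := by ring

lemma eC_add (s t : ℝ) : eC (s + t) = eC s * eC t := by
  rw [eC, eC, eC, ← Complex.exp_add]
  push_cast
  ring_nf

lemma eC_zero : eC 0 = 1 := by simp [eC]

lemma norm_eC (t : ℝ) : ‖eC t‖ = 1 := by
  rw [eC, show (2 * Real.pi * Complex.I * t : ℂ) = ((2 * Real.pi * t : ℝ) : ℂ) * Complex.I by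
    push_cast; ring, Complex.norm_exp_ofReal_mul_I]

lemma eC_sum {ι : Type*} (s : Finset ι) (t : ι → ℝ) : eC (∑ i ∈ s, t i) = ∏ i ∈ s, eC (t i) := by
  classical
  induction s using Finset.induction_on with
  | empty => simp [eC_zero]
  | insert a s ha ih => rw [Finset.sum_insert ha, Finset.prod_insert ha, eC_add, ih]

lemma continuous_eC : Continuous eC := by
  unfold eC
  fun_prop

lemma SN_eq_sum_Icc {N : ℝ} (hN : 0 ≤ N) (θ ξ : ℝ) :
    SN N θ ξ = ∑ u ∈ Finset.Icc (0 : ℤ) ⌊N⌋, eC (θ * (u : ℝ) ^ 2 + ξ * u) := by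
  have h := Int.natCast_floor_eq_floor hN
  rw [SN]
  refine Finset.sum_nbij (fun u => (u : ℤ)) ?_ ?_ ?_ ?_
  · intro u hu
    have := Finset.mem_range.mp hu
    simp only [Finset.mem_Icc]
    omega
  · exact fun _ _ _ _ h => Int.natCast_inj.mp h
  · intro u hu
    have := Finset.mem_Icc.mp (Finset.mem_coe.mp hu)
    exact ⟨u.toNat, by simp only [Finset.coe_range, Set.mem_Iio]; omega, by simp only; omega⟩
  · intro u _
    simp

lemma FN_eq_sum_box (d : ℕ) {N : ℝ} (hN : 0 ≤ N) (θ : ℝ) (ξ : Fin d → ℝ) :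
    FN d N θ ξ = ∑ u ∈ box d N,
      eC (θ * ((∑ i, u i ^ 2 : ℤ) : ℝ)) * ∏ i, eC (ξ i * (u i : ℝ)) := by
  rw [FN, Finset.prod_congr rfl fun i _ => SN_eq_sum_Icc hN θ (ξ i), Finset.prod_univ_sum]
  refine Finset.sum_congr rfl fun u _ => ?_
  push_cast
  rw [Finset.mul_sum, eC_sum, ← Finset.prod_mul_distrib]
  exact Finset.prod_congr rfl fun i _ => eC_add _ _

lemma FN0_eq_sum_box (d : ℕ) {N : ℝ} (hN : 0 ≤ N) (θ : ℝ) :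
    FN0 d N θ = ∑ u ∈ box d N, eC (θ * ((∑ i, u i ^ 2 : ℤ) : ℝ)) := by
  have h := FN_eq_sum_box d hN θ 0
  simp only [FN, Pi.zero_apply, Finset.prod_const, Finset.card_univ, Fintype.card_fin, zero_mul,
    eC_zero, one_pow, mul_one] at h
  exact h

lemma norm_SN_le (N θ ξ : ℝ) : ‖SN N θ ξ‖ ≤ ⌊N⌋₊ + 1 := by
  refine (norm_sum_le _ _).trans ?_
  simp [norm_eC]

lemma norm_FN_le (d : ℕ) (N θ : ℝ) (ξ : Fin d → ℝ) : ‖FN d N θ ξ‖ ≤ (⌊N⌋₊ + 1) ^ d := by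
  rw [FN, norm_prod]
  refine (Finset.prod_le_prod (fun _ _ => norm_nonneg _) fun i _ => norm_SN_le N θ (ξ i)).trans ?_
  simp

lemma bddAbove_norm_FN (d : ℕ) (N θ : ℝ) : BddAbove (Set.range fun ξ => ‖FN d N θ ξ‖) :=
  ⟨_, Set.forall_mem_range.mpr (norm_FN_le d N θ)⟩

lemma norm_FN0_le (d : ℕ) (N θ : ℝ) : ‖FN0 d N θ‖ ≤ (⌊N⌋₊ + 1) ^ d := by
  rw [FN0, norm_pow]
  exact pow_le_pow_left₀ (norm_nonneg _) (norm_SN_le N θ 0) d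

lemma continuous_SN (N ξ : ℝ) : Continuous fun θ => SN N θ ξ :=
  continuous_finsetSum _ fun _ _ => continuous_eC.comp (by fun_prop)

lemma continuous_FN (d : ℕ) (N : ℝ) (ξ : Fin d → ℝ) : Continuous fun θ => FN d N θ ξ :=
  continuous_finsetProd _ fun i _ => continuous_SN N (ξ i)

lemma continuous_FN0 (d : ℕ) (N : ℝ) : Continuous fun θ => FN0 d N θ :=
  (continuous_SN N 0).pow d

lemma measurable_iSup_norm_FN (d : ℕ) (N : ℝ) :
    Measurable fun θ => ⨆ ξ : Fin d → ℝ, ‖FN d N θ ξ‖ :=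
  (lowerSemicontinuous_ciSup (fun θ => bddAbove_norm_FN d N θ) fun ξ =>
    (continuous_FN d N ξ).norm.lowerSemicontinuous).measurable

lemma volume_minorArcs_lt_top (N : ℝ) : volume (minorArcs N) < ∞ :=
  (measure_mono Set.sdiff_subset).trans_lt (by simp)

/-- Convolution with the quadratic phase on the box. -/
def phaseConv (d : ℕ) (N θ : ℝ) (f : V d → ℂ) (x : V d) : ℂ :=
  ∑ u ∈ box d N, eC (θ * ((∑ i, u i ^ 2 : ℤ) : ℝ)) * f (x - u)

lemma continuous_phaseConv (d : ℕ) (N : ℝ) (f : V d → ℂ) (x : V d) :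
    Continuous fun θ => phaseConv d N θ f x :=
  continuous_finsetSum _ fun _ _ => (continuous_eC.comp (by fun_prop)).mul continuous_const

lemma sum_box_sum_box_eq (d lam : ℕ) {N : ℝ} (hN : 0 ≤ N) (θ : ℝ) (f : V d → ℂ) (x : V d) :
    ∑ u ∈ box d N, ∑ v ∈ box d N,
        eC (θ * (((∑ i, u i ^ 2) + (∑ i, v i ^ 2) - (lam : ℤ) : ℤ) : ℝ)) * f (x - u) =
      eC (-(θ * lam)) * (FN0 d N θ * phaseConv d N θ f x) := by
  rw [FN0_eq_sum_box d hN, mul_comm (∑ u ∈ box d N, _) (phaseConv _ _ _ _ _), phaseConv,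
    Finset.sum_mul_sum, Finset.mul_sum]
  refine Finset.sum_congr rfl fun u _ => ?_
  rw [Finset.mul_sum]
  refine Finset.sum_congr rfl fun v _ => ?_
  have : θ * (((∑ i, u i ^ 2) + (∑ i, v i ^ 2) - (lam : ℤ) : ℤ) : ℝ) =
      -(θ * lam) + (θ * ((∑ i, u i ^ 2 : ℤ) : ℝ) + θ * ((∑ i, v i ^ 2 : ℤ) : ℝ)) := by
    push_cast
    ring
  rw [this, eC_add, eC_add]
  ring

section Plancherel

open UnitAddTorus

local instance : MeasureSpace UnitAddCircle := ⟨AddCircle.haarAddCircle⟩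

local instance : Measure.IsAddHaarMeasure (volume : Measure UnitAddCircle) :=
  inferInstanceAs (Measure.IsAddHaarMeasure AddCircle.haarAddCircle)

local instance : IsProbabilityMeasure (volume : Measure UnitAddCircle) :=
  inferInstanceAs (IsProbabilityMeasure AddCircle.haarAddCircle)

/-- Convolution on `ℤ^d` with a finitely supported kernel is bounded on `l²` by the supremum of
the Fourier transform of the kernel. -/
lemma sum_norm_conv_sq_le {d : ℕ} (s T F : Finset (V d)) (c f : V d → ℂ) {B : ℝ}
    (hB : ∀ t : UnitAddTorus (Fin d), ‖∑ u ∈ s, c u * mFourier u t‖ ≤ B)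
    (hT : ∀ x ∈ F, ∀ u ∈ s, x - u ∈ T) :
    ∑ x ∈ F, ‖∑ u ∈ s, c u * f (x - u)‖ ^ 2 ≤ B ^ 2 * ∑ y ∈ T, ‖f y‖ ^ 2 := by
  have hB0 : 0 ≤ B := (norm_nonneg _).trans (hB 0)
  have hon := orthonormal_mFourier (d := Fin d)
  set P : C(UnitAddTorus (Fin d), ℂ) := ∑ y ∈ T, f y • mFourier y with hP
  set k : C(UnitAddTorus (Fin d), ℂ) := ∑ u ∈ s, c u • mFourier u with hk
  set L := ContinuousMap.toLp (E := ℂ) 2 (volume : Measure (UnitAddTorus (Fin d))) ℂ with hL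
  have h1 : ‖L P‖ ^ 2 = ∑ y ∈ T, ‖f y‖ ^ 2 := by
    have : L P = ∑ y ∈ T, f y • mFourierLp 2 y := by rw [hP, map_sum]; simp only [map_smul]; rfl
    rw [this, @norm_sq_eq_re_inner ℂ, hon.inner_sum, map_sum]
    refine Finset.sum_congr rfl fun y _ => ?_
    rw [mul_comm, RCLike.mul_conj, ← RCLike.ofReal_pow, RCLike.ofReal_re]
  have h2 : ‖L (k * P)‖ ≤ B * ‖L P‖ := by
    refine Lp.norm_le_mul_norm_of_ae_le_mul ?_
    filter_upwards [ContinuousMap.coeFn_toLp (E := ℂ) (p := 2) (𝕜 := ℂ) volume (k * P),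
      ContinuousMap.coeFn_toLp (E := ℂ) (p := 2) (𝕜 := ℂ) volume P] with t e1 e2
    rw [hL, e1, e2, ContinuousMap.mul_apply, norm_mul]
    refine mul_le_mul_of_nonneg_right ?_ (norm_nonneg _)
    have hkt : k t = ∑ u ∈ s, c u * mFourier u t := by
      rw [hk, ContinuousMap.sum_apply]
      rfl
    exact hkt ▸ hB t
  have h3 : L (k * P) = ∑ u ∈ s, ∑ y ∈ T, (c u * f y) • mFourierLp 2 (u + y) := by
    have : k * P = ∑ u ∈ s, ∑ y ∈ T, (c u * f y) • mFourier (u + y) := by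
      rw [hk, hP, Finset.sum_mul_sum]
      refine Finset.sum_congr rfl fun u _ => Finset.sum_congr rfl fun y _ => ?_
      ext t
      simp only [ContinuousMap.mul_apply, ContinuousMap.smul_apply, mFourier_add, smul_eq_mul]
      ring
    rw [this, map_sum]
    simp only [map_sum, map_smul]
    rfl
  have h4 : ∀ x ∈ F, inner ℂ (mFourierLp 2 x) (L (k * P)) = ∑ u ∈ s, c u * f (x - u) := by
    intro x hx
    rw [h3, inner_sum]
    refine Finset.sum_congr rfl fun u hu => ?_
    rw [inner_sum]
    simp only [inner_smul_right, orthonormal_iff_ite.mp hon]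
    rw [Finset.sum_eq_single_of_mem (x - u) (hT x hx u hu)]
    · simp
    · intro y _ hy
      rw [if_neg, mul_zero]
      rintro rfl
      exact hy (by abel)
  calc ∑ x ∈ F, ‖∑ u ∈ s, c u * f (x - u)‖ ^ 2
      = ∑ x ∈ F, ‖inner ℂ (mFourierLp 2 x) (L (k * P))‖ ^ 2 :=
        Finset.sum_congr rfl fun x hx => by rw [h4 x hx]
    _ ≤ ‖L (k * P)‖ ^ 2 := hon.sum_inner_products_le _
    _ ≤ (B * ‖L P‖) ^ 2 := pow_le_pow_left₀ (norm_nonneg _) h2 2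
    _ = B ^ 2 * ∑ y ∈ T, ‖f y‖ ^ 2 := by rw [mul_pow, h1]

lemma norm_sum_box_mFourier_le (d : ℕ) {N : ℝ} (hN : 0 ≤ N) (θ : ℝ)
    (t : UnitAddTorus (Fin d)) :
    ‖∑ u ∈ box d N, eC (θ * ((∑ i, u i ^ 2 : ℤ) : ℝ)) * mFourier u t‖ ≤
      ⨆ ξ : Fin d → ℝ, ‖FN d N θ ξ‖ := by
  choose ξ hξ using fun i => QuotientAddGroup.mk_surjective (t i)
  have : ∑ u ∈ box d N, eC (θ * ((∑ i, u i ^ 2 : ℤ) : ℝ)) * mFourier u t = FN d N θ ξ := by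
    rw [FN_eq_sum_box d hN]
    refine Finset.sum_congr rfl fun u _ => ?_
    refine congrArg _ ?_
    change ∏ i, fourier (u i) (t i) = _
    refine Finset.prod_congr rfl fun i _ => ?_
    rw [← hξ i]
    refine (fourier_coe_apply (T := 1)).trans ?_
    rw [eC]
    push_cast
    congr 1
    ring
  rw [this]
  exact le_ciSup (bddAbove_norm_FN d N θ) ξ

end Plancherel

lemma sum_enorm_phaseConv_sq_le (d : ℕ) {N : ℝ} (hN : 0 ≤ N) (θ : ℝ) (f : V d → ℂ)
    (F : Finset (V d)) :
    ∑ x ∈ F, ‖phaseConv d N θ f x‖ₑ ^ (2 : ℝ) ≤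
      (ENNReal.ofReal (⨆ ξ : Fin d → ℝ, ‖FN d N θ ξ‖) * lpNorm d 2 f) ^ (2 : ℝ) := by
  classical
  set T := (F ×ˢ box d N).image fun p => p.1 - p.2
  set B := ⨆ ξ : Fin d → ℝ, ‖FN d N θ ξ‖
  have hB : 0 ≤ B := Real.iSup_nonneg fun _ => norm_nonneg _
  have h := sum_norm_conv_sq_le (box d N) T F (fun u => eC (θ * ((∑ i, u i ^ 2 : ℤ) : ℝ))) f
    (norm_sum_box_mFourier_le d hN θ) fun x hx u hu =>
      Finset.mem_image.mpr ⟨(x, u), Finset.mk_mem_product hx hu, rfl⟩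
  have key : ∀ z : ℂ, ‖z‖ₑ ^ (2 : ℝ) = ENNReal.ofReal (‖z‖ ^ 2) := fun z => by
    rw [ENNReal.ofReal_pow (norm_nonneg _), ofReal_norm, ENNReal.rpow_ofNat]
  calc ∑ x ∈ F, ‖phaseConv d N θ f x‖ₑ ^ (2 : ℝ)
      = ENNReal.ofReal (∑ x ∈ F, ‖phaseConv d N θ f x‖ ^ 2) := by
        rw [ENNReal.ofReal_sum_of_nonneg fun _ _ => sq_nonneg _]
        exact Finset.sum_congr rfl fun x _ => key _
    _ ≤ ENNReal.ofReal (B ^ 2 * ∑ y ∈ T, ‖f y‖ ^ 2) := ENNReal.ofReal_le_ofReal h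
    _ = ENNReal.ofReal B ^ (2 : ℝ) * ∑ y ∈ T, ‖f y‖ₑ ^ (2 : ℝ) := by
        rw [ENNReal.ofReal_mul (sq_nonneg _), ENNReal.ofReal_pow hB, ENNReal.rpow_ofNat,
          ENNReal.ofReal_sum_of_nonneg fun _ _ => sq_nonneg _]
        simp only [key]
    _ ≤ ENNReal.ofReal B ^ (2 : ℝ) * ∑' y, ‖f y‖ₑ ^ (2 : ℝ) := by
        gcongr
        exact ENNReal.sum_le_tsum T
    _ = (ENNReal.ofReal B * lpNorm d 2 f) ^ (2 : ℝ) := by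
        rw [ENNReal.mul_rpow_of_nonneg _ _ zero_le_two, _root_.lpNorm, ← ENNReal.rpow_mul]
        norm_num
        rfl

/-- Minkowski's integral inequality for finite `l²` sums. -/
lemma sum_lintegral_sq_le {α ι : Type*} [MeasurableSpace α] {μ : Measure α} (F : Finset ι)
    {g : ι → α → ℝ≥0∞} (hg : ∀ i, Measurable (g i)) (hfin : ∀ i, ∫⁻ a, g i a ∂μ ≠ ∞)
    {b : α → ℝ≥0∞} (hb : ∀ a, ∑ i ∈ F, g i a ^ (2 : ℝ) ≤ b a ^ (2 : ℝ)) :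
    ∑ i ∈ F, (∫⁻ a, g i a ∂μ) ^ (2 : ℝ) ≤ (∫⁻ a, b a ∂μ) ^ (2 : ℝ) := by
  set G : ι → ℝ≥0∞ := fun i => ∫⁻ a, g i a ∂μ with hG
  set S := ∑ i ∈ F, G i ^ (2 : ℝ) with hS
  have hSfin : S ≠ ∞ := ENNReal.sum_ne_top.mpr fun i _ =>
    ENNReal.rpow_ne_top_of_nonneg zero_le_two (hfin i)
  set R := S ^ (1 / (2 : ℝ)) with hR
  have hRfin : R ≠ ∞ := ENNReal.rpow_ne_top_of_nonneg (by norm_num) hSfin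
  have hSR : S = R * R := by
    rw [hR, ← ENNReal.rpow_add_of_nonneg _ _ (by norm_num) (by norm_num)]
    norm_num
  have h1 : R * R ≤ R * ∫⁻ a, b a ∂μ := by
    calc R * R = ∑ i ∈ F, G i * ∫⁻ a, g i a ∂μ := by
          rw [← hSR, hS]
          refine Finset.sum_congr rfl fun i _ => ?_
          rw [ENNReal.rpow_two, sq]
      _ = ∫⁻ a, ∑ i ∈ F, G i * g i a ∂μ := by
          rw [lintegral_finsetSum _ fun i _ => (hg i).const_mul _]
          exact Finset.sum_congr rfl fun i _ => (lintegral_const_mul _ (hg i)).symm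
      _ ≤ ∫⁻ a, R * b a ∂μ := by
          refine lintegral_mono fun a => ?_
          refine (ENNReal.inner_le_Lp_mul_Lq F G (fun i => g i a)
            Real.HolderConjugate.two_two).trans ?_
          refine mul_le_mul' le_rfl ?_
          refine (ENNReal.rpow_le_rpow (hb a) (by norm_num)).trans ?_
          rw [← ENNReal.rpow_mul]
          norm_num
      _ = R * ∫⁻ a, b a ∂μ := lintegral_const_mul' _ _ hRfin
  have h2 : R ≤ ∫⁻ a, b a ∂μ := by
    by_cases h0 : R = 0
    · simp [h0]
    · exact (ENNReal.mul_le_mul_iff_right h0 hRfin).mp h1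
  rw [hSR, ENNReal.rpow_two, sq]
  exact mul_le_mul' h2 h2

lemma enorm_Eminor_le (d lam : ℕ) {N : ℝ} (hN : 0 ≤ N) (f : V d → ℂ) (x : V d) :
    ‖Eminor d lam N f x‖ₑ ≤ ‖(Ncount d lam : ℂ)⁻¹‖ₑ *
      ∫⁻ θ in minorArcs N, ‖FN0 d N θ‖ₑ * ‖phaseConv d N θ f x‖ₑ := by
  rw [Eminor, enorm_mul]
  refine mul_le_mul' le_rfl ((enorm_integral_le_lintegral_enorm _).trans (le_of_eq ?_))
  refine lintegral_congr fun θ => ?_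
  have h1 : ‖eC (-(θ * lam))‖ₑ = 1 := by rw [← ofReal_norm, norm_eC, ENNReal.ofReal_one]
  rw [sum_box_sum_box_eq d lam hN, enorm_mul, enorm_mul, h1, one_mul]

lemma lintegral_enorm_mul_phaseConv_ne_top (d : ℕ) (N : ℝ) (f : V d → ℂ) (x : V d) :
    ∫⁻ θ in minorArcs N, ‖FN0 d N θ‖ₑ * ‖phaseConv d N θ f x‖ₑ ≠ ∞ := by
  have hc : Continuous fun θ => FN0 d N θ * phaseConv d N θ f x :=
    (continuous_FN0 d N).mul (continuous_phaseConv d N f x)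
  have := ((hc.integrableOn_Icc (a := 0) (b := 1) (μ := volume)).mono_set
    (Set.sdiff_subset : minorArcs N ⊆ _)).hasFiniteIntegral
  simp only [HasFiniteIntegral, enorm_mul] at this
  exact this.ne

lemma lintegral_iSup_norm_FN_mul (d : ℕ) (N : ℝ) :
    ∫⁻ θ in minorArcs N, ‖FN0 d N θ‖ₑ * ENNReal.ofReal (⨆ ξ : Fin d → ℝ, ‖FN d N θ ξ‖) =
      ENNReal.ofReal (∫ θ in minorArcs N, (⨆ ξ : Fin d → ℝ, ‖FN d N θ ξ‖) * ‖FN0 d N θ‖) := by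
  have h0 : ∀ θ, 0 ≤ ⨆ ξ : Fin d → ℝ, ‖FN d N θ ξ‖ := fun θ =>
    Real.iSup_nonneg fun _ => norm_nonneg _
  have hm : Measurable fun θ => (⨆ ξ : Fin d → ℝ, ‖FN d N θ ξ‖) * ‖FN0 d N θ‖ :=
    (measurable_iSup_norm_FN d N).mul (continuous_FN0 d N).norm.measurable
  rw [ofReal_integral_eq_lintegral_ofReal]
  · refine lintegral_congr fun θ => ?_
    rw [ENNReal.ofReal_mul (h0 θ), ofReal_norm, mul_comm]
  · refine Measure.integrableOn_of_bounded (M := (⌊N⌋₊ + 1) ^ d * (⌊N⌋₊ + 1) ^ d)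
      (volume_minorArcs_lt_top N).ne hm.aestronglyMeasurable (Filter.Eventually.of_forall fun θ => ?_)
    rw [norm_mul, norm_norm, Real.norm_of_nonneg (h0 θ)]
    exact mul_le_mul (ciSup_le (norm_FN_le d N θ)) (norm_FN0_le d N θ) (norm_nonneg _)
      (by positivity)
  · exact Filter.Eventually.of_forall fun θ => mul_nonneg (h0 θ) (norm_nonneg _)

/-- Dyadic `l²` bound for the minor-arc maximal error in terms of the
minor-arc integral of the exponential sums: with `Λ = 2^j` and `N = Λ^{1/2}`,
`‖sup_{λ ∈ [Λ,2Λ)} |E_{m,λ} f|‖_{l²} ≤ C N(Λ)⁻¹ (∫_{m_N} sup_ξ |F_N(θ,ξ)| |F_N(θ)| dθ) ‖f‖_{l²}`. -/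
theorem minor_arc_l2_via_integral (d : ℕ) (hd : 3 ≤ d) :
    ∃ C : ℝ≥0, ∀ j : ℕ, ∀ f : V d → ℂ,
      lpNormE d 2
        (fun x => ⨆ (lam : ℕ) (_ : 2 ^ j ≤ lam ∧ lam < 2 ^ (j + 1)),
          (‖Eminor d lam (Real.sqrt ((2 : ℝ) ^ j)) f x‖₊ : ℝ≥0∞)) ≤
      C * (Ncount d (2 ^ j) : ℝ≥0∞)⁻¹ *
        ENNReal.ofReal
          (∫ θ in minorArcs (Real.sqrt ((2 : ℝ) ^ j)),
            (⨆ ξ : Fin d → ℝ, ‖FN d (Real.sqrt ((2 : ℝ) ^ j)) θ ξ‖) *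
              ‖FN0 d (Real.sqrt ((2 : ℝ) ^ j)) θ‖) *
        lpNorm d 2 f := by
  obtain ⟨C, hC⟩ := exists_Ncount_le d hd
  refine ⟨C, fun j f => ?_⟩
  set N := Real.sqrt ((2 : ℝ) ^ j)
  have hN : 0 ≤ N := Real.sqrt_nonneg _
  set K : ℝ≥0∞ := ((C : ℝ≥0) : ℝ≥0∞) * (Ncount d (2 ^ j) : ℝ≥0∞)⁻¹
  set g : V d → ℝ → ℝ≥0∞ := fun x θ => ‖FN0 d N θ‖ₑ * ‖phaseConv d N θ f x‖ₑ
  set b : ℝ → ℝ≥0∞ := fun θ =>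
    ‖FN0 d N θ‖ₑ * ENNReal.ofReal (⨆ ξ : Fin d → ℝ, ‖FN d N θ ξ‖) * lpNorm d 2 f
  have hK : ∀ x, (⨆ (lam : ℕ) (_ : 2 ^ j ≤ lam ∧ lam < 2 ^ (j + 1)),
      (‖Eminor d lam N f x‖₊ : ℝ≥0∞)) ≤ K * ∫⁻ θ in minorArcs N, g x θ := by
    refine fun x => iSup₂_le fun lam hlam => (enorm_Eminor_le d lam hN f x).trans ?_
    refine mul_le_mul' ?_ le_rfl
    have h1 : ∀ m, Ncount d m ≠ 0 := fun m => by
      have := one_le_Ncount (d - 2) m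
      rw [show d - 2 + 2 = d by omega] at this
      omega
    have h2 : ‖(Ncount d lam : ℂ)⁻¹‖ₑ = (Ncount d lam : ℝ≥0∞)⁻¹ := by
      rw [enorm_inv (Nat.cast_ne_zero.mpr (h1 lam))]
      rw [← ofReal_norm, Complex.norm_natCast, ENNReal.ofReal_natCast]
    have h3 : (Ncount d (2 ^ j) : ℝ≥0∞) ≤ (C : ℝ≥0∞) * Ncount d lam := by
      exact_mod_cast hC (2 ^ j) lam Nat.one_le_two_pow hlam.1
    have h4 : ∀ m, (Ncount d m : ℝ≥0∞) * (Ncount d m : ℝ≥0∞)⁻¹ = 1 := fun m =>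
      ENNReal.mul_inv_cancel (Nat.cast_ne_zero.mpr (h1 m)) (ENNReal.natCast_ne_top _)
    calc ‖(Ncount d lam : ℂ)⁻¹‖ₑ
        = (Ncount d lam : ℝ≥0∞)⁻¹ * (Ncount d (2 ^ j) * (Ncount d (2 ^ j) : ℝ≥0∞)⁻¹) := by
          rw [h2, h4, mul_one]
      _ ≤ (Ncount d lam : ℝ≥0∞)⁻¹ * (C * Ncount d lam * (Ncount d (2 ^ j) : ℝ≥0∞)⁻¹) := by
          gcongr
      _ = Ncount d lam * (Ncount d lam : ℝ≥0∞)⁻¹ * (C * (Ncount d (2 ^ j) : ℝ≥0∞)⁻¹) := by ring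
      _ = K := by
          rw [h4, one_mul]
          simp [K]
  have hb : ∫⁻ θ in minorArcs N, b θ = ENNReal.ofReal (∫ θ in minorArcs N,
      (⨆ ξ : Fin d → ℝ, ‖FN d N θ ξ‖) * ‖FN0 d N θ‖) * lpNorm d 2 f := by
    rw [← lintegral_iSup_norm_FN_mul, lintegral_mul_const]
    exact (continuous_FN0 d N).enorm.measurable.mul (measurable_iSup_norm_FN d N).ennreal_ofReal
  rw [mul_assoc, ← hb, lpNormE, one_div, ENNReal.rpow_inv_le_iff two_pos,
    ENNReal.tsum_eq_iSup_sum]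
  refine iSup_le fun F => ?_
  calc _ ≤ ∑ x ∈ F, (K * ∫⁻ θ in minorArcs N, g x θ) ^ (2 : ℝ) :=
        Finset.sum_le_sum fun x _ => ENNReal.rpow_le_rpow (hK x) zero_le_two
    _ = K ^ (2 : ℝ) * ∑ x ∈ F, (∫⁻ θ in minorArcs N, g x θ) ^ (2 : ℝ) := by
        rw [Finset.mul_sum]
        exact Finset.sum_congr rfl fun x _ => ENNReal.mul_rpow_of_nonneg _ _ zero_le_two
    _ ≤ K ^ (2 : ℝ) * (∫⁻ θ in minorArcs N, b θ) ^ (2 : ℝ) := by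
        refine mul_le_mul' le_rfl (sum_lintegral_sq_le F
          (fun x => (continuous_FN0 d N).enorm.measurable.mul
            (continuous_phaseConv d N f x).enorm.measurable)
          (fun x => lintegral_enorm_mul_phaseConv_ne_top d N f x) fun θ => ?_)
        change ∑ x ∈ F, (‖FN0 d N θ‖ₑ * ‖phaseConv d N θ f x‖ₑ) ^ (2 : ℝ) ≤ _
        simp only [b, mul_assoc, ENNReal.mul_rpow_of_nonneg ‖FN0 d N θ‖ₑ _ zero_le_two]
        rw [← Finset.mul_sum]
        exact mul_le_mul' le_rfl (sum_enorm_phaseConv_sq_le d hN θ f F)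
    _ = _ := (ENNReal.mul_rpow_of_nonneg _ _ zero_le_two).symm
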